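/- Let f be a nonzero homogeneous polynomial of degree 3 in four variables over ℚ defining a smooth cubic surface V(f). If V(f) contains three pairwise skew lines defined over ℚ (a skew triple of ℚ-lines), then the number of lines on V(f) defined over ℚ is 3, 7, 9, 15, or 27. -/

import Mathlib

open MvPolynomial

/-- The restriction of `f` to the line spanned by `v` and `w`:
the polynomial `f (s • v + t • w)` in the two variables `s, t`. -/
noncomputable def lineRestrict {k : Type*} [CommRing k] (f : MvPolynomial (Fin 4) k)
    (v w : Fin 4 → k) : MvPolynomial (Fin 2) k :=
  aeval (fun i => C (v i) * X 0 + C (w i) * X 1) f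

/-- `W` is a line on the cubic surface `V(f)` defined over `k`: a 2-dimensional
`k`-linear subspace of `k⁴` on which `f` vanishes identically as a polynomial. -/
def IsLineOn {k : Type*} [Field k] (f : MvPolynomial (Fin 4) k)
    (W : Submodule k (Fin 4 → k)) : Prop :=
  Module.finrank k W = 2 ∧
    ∃ v w : Fin 4 → k, Submodule.span k {v, w} = W ∧ lineRestrict f v w = 0

/-- `f` defines a smooth cubic surface over `k`: `f` is a nonzero homogeneous cubic
and, over an algebraic closure, the only common zero of `f` and its partial
derivatives is the origin. -/
def IsSmoothCubic (k : Type*) [Field k] (f : MvPolynomial (Fin 4) k) : Prop :=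
  f ≠ 0 ∧ f.IsHomogeneous 3 ∧
    ∀ x : Fin 4 → AlgebraicClosure k,
      (eval x (map (algebraMap k (AlgebraicClosure k)) f) = 0 ∧
        ∀ i : Fin 4, eval x (map (algebraMap k (AlgebraicClosure k)) (pderiv i f)) = 0) →
      x = 0

namespace SimpleGraph

variable {α : Type*}

/-- Every edge lies in a triangle, and every vertex outside the triangle is adjacent to exactly
one of its vertices. This is the incidence structure of lines and tritangent planes on a smooth
cubic surface. -/
def IsTritangent (G : SimpleGraph α) : Prop :=
  ∀ ⦃a b⦄, G.Adj a b → ∃ c, G.Adj a c ∧ G.Adj b c ∧ ∀ d, d ≠ a → d ≠ b → d ≠ c →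
    (G.Adj d a ∧ ¬ G.Adj d b ∧ ¬ G.Adj d c) ∨ (¬ G.Adj d a ∧ G.Adj d b ∧ ¬ G.Adj d c) ∨
      (¬ G.Adj d a ∧ ¬ G.Adj d b ∧ G.Adj d c)

/-- Three distinct pairwise non-adjacent vertices. -/
structure SkewTriple (G : SimpleGraph α) (a b c : α) : Prop where
  ne_ab : a ≠ b
  ne_ac : a ≠ c
  ne_bc : b ≠ c
  nadj_ab : ¬ G.Adj a b
  nadj_ac : ¬ G.Adj a c
  nadj_bc : ¬ G.Adj b c

/-- The vertices adjacent to all of `a, b, c`. -/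
def transversals (G : SimpleGraph α) (a b c : α) : Set α :=
  {n | G.Adj n a ∧ G.Adj n b ∧ G.Adj n c}

/-- The vertices adjacent to `a` and `b` but not to `c`. -/
def adjBoth (G : SimpleGraph α) (a b c : α) : Set α :=
  {n | G.Adj n a ∧ G.Adj n b ∧ ¬ G.Adj n c}

/-- The vertices adjacent to `a` but neither to `b` nor to `c`. -/
def adjOnly (G : SimpleGraph α) (a b c : α) : Set α :=
  {n | G.Adj n a ∧ ¬ G.Adj n b ∧ ¬ G.Adj n c}

/-- The vertices other than `a, b, c` that are adjacent to none of them. -/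
def adjNone (G : SimpleGraph α) (a b c : α) : Set α :=
  {n | (n ≠ a ∧ n ≠ b ∧ n ≠ c) ∧ ¬ G.Adj n a ∧ ¬ G.Adj n b ∧ ¬ G.Adj n c}

open Classical in
/-- The third vertex of the tritangent triangle on the edge `a b`; `b` if there is no edge. -/
noncomputable def third {G : SimpleGraph α} (hG : G.IsTritangent) (a b : α) : α :=
  if h : G.Adj a b then (hG h).choose else b

namespace IsTritangent

variable {G : SimpleGraph α} {a b c d m n : α}

lemma third_spec (hG : G.IsTritangent) (h : G.Adj a b) :
    G.Adj a (third hG a b) ∧ G.Adj b (third hG a b) ∧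
      ∀ d, d ≠ a → d ≠ b → d ≠ third hG a b →
    (G.Adj d a ∧ ¬ G.Adj d b ∧ ¬ G.Adj d (third hG a b)) ∨
    (¬ G.Adj d a ∧ G.Adj d b ∧ ¬ G.Adj d (third hG a b)) ∨
      (¬ G.Adj d a ∧ ¬ G.Adj d b ∧ G.Adj d (third hG a b)) := by
  rw [third, dif_pos h]
  exact (hG h).choose_spec

lemma eq_third (hG : G.IsTritangent) (h : G.Adj a b) (hm : G.Adj m a) (hm' : G.Adj m b) :
    m = third hG a b := by
  by_contra hne
  have := (hG.third_spec h).2.2 m hm.ne hm'.ne hne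
  tauto

lemma adj_third (hG : G.IsTritangent) (h : G.Adj a b) : G.Adj a (third hG a b) :=
  (hG.third_spec h).1

lemma third_third (hG : G.IsTritangent) (a b : α) : third hG a (third hG a b) = b := by
  by_cases h : G.Adj a b
  · obtain ⟨h1, h2, -⟩ := hG.third_spec h
    exact (hG.eq_third h1 h.symm h2).symm
  · have : third hG a b = b := by rw [third, dif_neg h]
    rw [this, this]

lemma adj_third_iff (hG : G.IsTritangent) : G.Adj (third hG a b) a ↔ G.Adj b a := by
  by_cases h : G.Adj a b
  · exact iff_of_true (hG.adj_third h).symm h.symm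
  · rw [third, dif_neg h]

/-- A vertex neither equal nor adjacent to `a` is adjacent to exactly one of `b` and
`third a b`. -/
lemma third_adj_iff (hG : G.IsTritangent) (h : G.Adj a b) (hd : d ≠ a) (hda : ¬ G.Adj d a) :
    G.Adj (third hG a b) d ↔ ¬ G.Adj b d := by
  obtain ⟨h1, h2, h3⟩ := hG.third_spec h
  have hb : d ≠ b := by rintro rfl; exact hda h.symm
  have hc : d ≠ third hG a b := by rintro rfl; exact hda h1.symm
  have := h3 d hd hb hc
  rw [G.adj_comm _ d, G.adj_comm _ d]
  tauto

/-- `third a` as a permutation of all the vertices. -/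
noncomputable def thirdEquiv (hG : G.IsTritangent) (a : α) : Equiv.Perm α :=
  Function.Involutive.toPerm (third hG a) (hG.third_third a)

lemma encard_eq_of_third (hG : G.IsTritangent) (a : α) {s t : Set α}
    (h : ∀ n ∈ s, third hG a n ∈ t) (h' : ∀ n ∈ t, third hG a n ∈ s) : s.encard = t.encard := by
  have : third hG a '' s = t := by
    ext n
    refine ⟨?_, fun hn => ⟨_, h' n hn, hG.third_third a n⟩⟩
    rintro ⟨m, hm, rfl⟩
    exact h m hm
  rw [← this]
  exact ((hG.thirdEquiv a).injective.encard_image s).symm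

end IsTritangent

namespace SkewTriple

variable {G : SimpleGraph α} {a b c d m n m₁ m₂ m₃ : α}

lemma swap (h : G.SkewTriple a b c) : G.SkewTriple b a c :=
  ⟨h.1.symm, h.3, h.2, fun e => h.4 e.symm, h.6, h.5⟩

lemma rotate (h : G.SkewTriple a b c) : G.SkewTriple b c a :=
  ⟨h.3, h.1.symm, h.2.symm, h.6, fun e => h.4 e.symm, fun e => h.5 e.symm⟩

lemma encard_adjOnly (hG : G.IsTritangent) (h : G.SkewTriple a b c) :
    (G.adjOnly a b c).encard = (G.transversals a b c).encard := by
  refine hG.encard_eq_of_third a (fun n hn => ?_) (fun n hn => ?_)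
  · exact ⟨hG.adj_third_iff.2 hn.1,
      (hG.third_adj_iff hn.1.symm h.ne_ab.symm fun e => h.nadj_ab e.symm).2 hn.2.1,
      (hG.third_adj_iff hn.1.symm h.ne_ac.symm fun e => h.nadj_ac e.symm).2 hn.2.2⟩
  · refine ⟨hG.adj_third_iff.2 hn.1, ?_, ?_⟩
    · rw [hG.third_adj_iff hn.1.symm h.ne_ab.symm fun e => h.nadj_ab e.symm]
      exact not_not.2 hn.2.1
    · rw [hG.third_adj_iff hn.1.symm h.ne_ac.symm fun e => h.nadj_ac e.symm]
      exact not_not.2 hn.2.2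

lemma third_mem_adjBoth (hG : G.IsTritangent) (h : G.SkewTriple a b c)
    (hn : n ∈ G.adjBoth a b c) : third hG a n ∈ G.adjBoth a c b := by
  refine ⟨hG.adj_third_iff.2 hn.1,
      (hG.third_adj_iff hn.1.symm h.ne_ac.symm fun e => h.nadj_ac e.symm).2 hn.2.2, ?_⟩
  rw [hG.third_adj_iff hn.1.symm h.ne_ab.symm fun e => h.nadj_ab e.symm]
  exact not_not.2 hn.2.1

lemma encard_adjBoth (hG : G.IsTritangent) (h : G.SkewTriple a b c) :
    (G.adjBoth a b c).encard = (G.adjBoth a c b).encard :=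
  hG.encard_eq_of_third a (fun _ hn => h.third_mem_adjBoth hG hn)
    (fun _ hn => h.rotate.rotate.swap.third_mem_adjBoth hG hn)

end SkewTriple

lemma adjBoth_comm (G : SimpleGraph α) (a b c : α) : G.adjBoth a b c = G.adjBoth b a c := by
  ext; simp only [adjBoth, Set.mem_ofPred_eq]; tauto

namespace SkewTriple

variable {G : SimpleGraph α} {a b c d m n m₁ m₂ m₃ : α}

/-- Going once around the hexagon of lines through `n` that meet two of `a, b, c`, one reaches the
line opposite to `n`. -/
lemma adjBoth_eq_pair (hG : G.IsTritangent) (h : G.SkewTriple a b c) (hn : n ∈ G.adjBoth a b c) :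
    ∃ n', n ≠ n' ∧ G.adjBoth a b c = {n, n'} := by
  have hn₁ := h.third_mem_adjBoth hG hn
  rw [adjBoth_comm] at hn₁
  have hn₂ := h.rotate.rotate.third_mem_adjBoth hG hn₁
  rw [adjBoth_comm] at hn₂
  have hn₃ := h.rotate.third_mem_adjBoth hG hn₂
  rw [adjBoth_comm] at hn₃
  have key : ∀ d ∈ G.adjBoth a b c, G.Adj (third hG c (third hG a n)) d ↔
      ¬ G.Adj (third hG a n) d := fun d hd =>
    hG.third_adj_iff hn₁.1.symm (by rintro rfl; exact h.nadj_ac hd.1.symm) hd.2.2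
  refine ⟨third hG b (third hG c (third hG a n)), ?_, ?_⟩
  rotate_left
  · refine Set.Subset.antisymm (fun d hd => ?_) ?_
    · by_cases hd' : G.Adj (third hG a n) d
      · left
        rw [hG.eq_third hn₁.2.1.symm hd.1 hd'.symm, hG.third_third]
      · right
        exact hG.eq_third hn₂.1.symm hd.2.1 ((key d hd).2 hd').symm
    · rintro d (rfl | rfl)
      exacts [hn, hn₃]
  · intro e
    refine (key n hn).1 ?_ (hG.third_spec hn.1.symm).2.1.symm
    nth_rewrite 2 [e]
    exact (hG.third_spec hn₂.1.symm).2.1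

lemma not_adj_of_mem_adjBoth (hG : G.IsTritangent) (h : G.SkewTriple a b c)
    (hn : n ∈ G.adjBoth a b c) (hm : m ∈ G.transversals a b c) : ¬ G.Adj n m := by
  intro hnm
  have e := hG.eq_third hm.1.symm hn.1 hnm
  have := hn.2.1
  rw [e, hG.third_adj_iff hm.1.symm h.ne_ab.symm fun e => h.nadj_ab e.symm] at this
  exact this hm.2.1

lemma not_adj_of_mem_transversals (hG : G.IsTritangent) (h : G.SkewTriple a b c)
    (hm : m ∈ G.transversals a b c) (hn : n ∈ G.transversals a b c) : ¬ G.Adj m n := fun hmn =>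
  h.ne_ab ((hG.eq_third hmn hm.1.symm hn.1.symm).trans
    (hG.eq_third hmn hm.2.1.symm hn.2.1.symm).symm)

lemma third_mem_adjOnly (hG : G.IsTritangent) (h : G.SkewTriple a b c)
    (hm : m ∈ G.transversals a b c) : third hG c m ∈ G.adjOnly c a b := by
  refine ⟨hG.adj_third_iff.2 hm.2.2, ?_, ?_⟩
  · rw [hG.third_adj_iff hm.2.2.symm h.ne_ac h.nadj_ac]
    exact not_not.2 hm.1
  · rw [hG.third_adj_iff hm.2.2.symm h.ne_bc h.nadj_bc]
    exact not_not.2 hm.2.1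

lemma third_third_mem_adjNone (hG : G.IsTritangent) (h : G.SkewTriple a b c)
    (hm : m ∈ G.transversals a b c) (hn : n ∈ G.adjBoth a b c) :
    third hG (third hG c m) n ∈ G.adjNone a b c := by
  have hR := h.third_mem_adjOnly hG hm
  have hnm := h.not_adj_of_mem_adjBoth hG hn hm
  have hnc : n ≠ c := by rintro rfl; exact h.nadj_ac hn.1.symm
  have hRn : G.Adj (third hG c m) n := by
    rw [hG.third_adj_iff hm.2.2.symm hnc hn.2.2, G.adj_comm]
    exact hnm
  have haR : a ≠ third hG c m := by
    intro e; rw [← e] at hR; exact h.nadj_ac hR.1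
  have hbR : b ≠ third hG c m := by
    intro e; rw [← e] at hR; exact h.nadj_bc hR.1
  have hK := hG.adj_third hRn
  refine ⟨⟨?_, ?_, ?_⟩, ?_, ?_, ?_⟩
  · intro e; rw [e] at hK; exact hR.2.1 hK
  · intro e; rw [e] at hK; exact hR.2.2 hK
  · intro e
    have := (hG.third_spec hRn).2.1
    rw [e] at this
    exact hn.2.2 this
  · rw [hG.third_adj_iff hRn haR fun e => hR.2.1 e.symm]
    exact not_not.2 hn.1
  · rw [hG.third_adj_iff hRn hbR fun e => hR.2.2 e.symm]
    exact not_not.2 hn.2.1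
  · intro e
    have := hG.eq_third hR.1 hK.symm e
    exact hnc ((hG.thirdEquiv (third hG c m)).injective this)

lemma third_third_mem_adjBoth (hG : G.IsTritangent) (h : G.SkewTriple a b c)
    (hm : m ∈ G.transversals a b c) (hn : n ∈ G.adjNone a b c) (hnm : ¬ G.Adj n m) :
    third hG (third hG c m) n ∈ G.adjBoth a b c := by
  have hR := h.third_mem_adjOnly hG hm
  have hRn : G.Adj (third hG c m) n := by
    rw [hG.third_adj_iff hm.2.2.symm hn.1.2.2 hn.2.2.2, G.adj_comm]
    exact hnm
  have haR : a ≠ third hG c m := by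
    intro e; rw [← e] at hR; exact h.nadj_ac hR.1
  have hbR : b ≠ third hG c m := by
    intro e; rw [← e] at hR; exact h.nadj_bc hR.1
  refine ⟨?_, ?_, ?_⟩
  · rw [hG.third_adj_iff hRn haR fun e => hR.2.1 e.symm, G.adj_comm, G.adj_comm]
    exact hn.2.1
  · rw [hG.third_adj_iff hRn hbR fun e => hR.2.2 e.symm]
    exact hn.2.2.1
  · intro e
    have := hG.eq_third hR.1 (hG.adj_third hRn).symm e
    exact hn.1.2.2 ((hG.thirdEquiv (third hG c m)).injective this)

lemma encard_adjNone_eq_adjBoth (hG : G.IsTritangent) (h : G.SkewTriple a b c)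
    (hm : m ∈ G.transversals a b c) (hN : ∀ n ∈ G.adjNone a b c, ¬ G.Adj n m) :
    (G.adjNone a b c).encard = (G.adjBoth a b c).encard :=
  hG.encard_eq_of_third (third hG c m)
    (fun n hn => h.third_third_mem_adjBoth hG hm hn (hN n hn))
    (fun _ hn => h.third_third_mem_adjNone hG hm hn)

lemma of_transversals (hG : G.IsTritangent) (h : G.SkewTriple a b c)
    (h₁ : m₁ ∈ G.transversals a b c) (h₂ : m₂ ∈ G.transversals a b c)
    (h₃ : m₃ ∈ G.transversals a b c) (h₁₂ : m₁ ≠ m₂) (h₁₃ : m₁ ≠ m₃) (h₂₃ : m₂ ≠ m₃) :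
    G.SkewTriple m₁ m₂ m₃ :=
  ⟨h₁₂, h₁₃, h₂₃, h.not_adj_of_mem_transversals hG h₁ h₂, h.not_adj_of_mem_transversals hG h₁ h₃,
    h.not_adj_of_mem_transversals hG h₂ h₃⟩

lemma third_third_mem_adjBoth_transversals (hG : G.IsTritangent) (h : G.SkewTriple a b c)
    (h₁ : m₁ ∈ G.transversals a b c) (h₂ : m₂ ∈ G.transversals a b c)
    (h₃ : m₃ ∈ G.transversals a b c) (h₁₂ : m₁ ≠ m₂) (h₁₃ : m₁ ≠ m₃)
    (hn : n ∈ G.adjBoth a b c) :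
    third hG (third hG c m₁) n ∈ G.adjBoth m₂ m₃ m₁ := by
  have hR := h.third_mem_adjOnly hG h₁
  have hnc : n ≠ c := by rintro rfl; exact h.nadj_ac hn.1.symm
  have hRn : G.Adj (third hG c m₁) n := by
    rw [hG.third_adj_iff h₁.2.2.symm hnc hn.2.2, G.adj_comm]
    exact h.not_adj_of_mem_adjBoth hG hn h₁
  have key : ∀ m ∈ G.transversals a b c, m₁ ≠ m → G.Adj (third hG (third hG c m₁) n) m := by
    intro m hm hne
    rw [hG.third_adj_iff hRn, G.adj_comm]
    · exact fun e => h.not_adj_of_mem_adjBoth hG hn hm e.symm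
    · rintro rfl
      exact hR.2.1 hm.1
    · intro e
      have := hG.eq_third hR.1.symm hm.2.2 e
      rw [hG.third_third] at this
      exact hne this.symm
  refine ⟨key _ h₂ h₁₂, key _ h₃ h₁₃, fun e => ?_⟩
  have := hG.eq_third (hG.third_spec h₁.2.2.symm).2.1.symm (hG.adj_third hRn).symm e
  have e' := (hG.thirdEquiv (third hG c m₁)).injective this
  exact hn.2.2 (e' ▸ h₁.2.2)

lemma adjBoth_nonempty_of_adjBoth (hG : G.IsTritangent) (h : G.SkewTriple a b c)
    (h₁ : m₁ ∈ G.transversals a b c) (h₂ : m₂ ∈ G.transversals a b c)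
    (h₃ : m₃ ∈ G.transversals a b c) (h₁₂ : m₁ ≠ m₂) (h₁₃ : m₁ ≠ m₃) 
    (hn : (G.adjBoth a b c).Nonempty) : (G.adjBoth m₂ m₃ m₁).Nonempty :=
  hn.imp' _ fun _ hn => h.third_third_mem_adjBoth_transversals hG h₁ h₂ h₃ h₁₂ h₁₃ hn

lemma encard_adjBoth_of_nonempty (hG : G.IsTritangent) (h : G.SkewTriple a b c)
    (hn : (G.adjBoth a b c).Nonempty) : (G.adjBoth a b c).encard = 2 := by
  obtain ⟨n, hn⟩ := hn
  obtain ⟨n', hne, e⟩ := h.adjBoth_eq_pair hG hn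
  rw [e, Set.encard_pair hne]

lemma encard_univ (hG : G.IsTritangent) (h : G.SkewTriple a b c) :
    (Set.univ : Set α).encard = 3 + 4 * (G.transversals a b c).encard +
      3 * (G.adjBoth a b c).encard + (G.adjNone a b c).encard := by
  have ha : ¬ G.Adj a a := G.irrefl
  have hb : ¬ G.Adj b b := G.irrefl
  have hc : ¬ G.Adj c c := G.irrefl
  have hab : ¬ G.Adj b a := fun e => h.nadj_ab e.symm
  have hac : ¬ G.Adj c a := fun e => h.nadj_ac e.symm
  have hbc : ¬ G.Adj c b := fun e => h.nadj_bc e.symm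
  have hu : (Set.univ : Set α) = {a, b, c} ∪ (G.transversals a b c ∪ (G.adjOnly a b c ∪
      (G.adjOnly b c a ∪ (G.adjOnly c a b ∪ (G.adjBoth a b c ∪ (G.adjBoth b c a ∪
      (G.adjBoth c a b ∪ G.adjNone a b c))))))) := by
    ext n
    simp only [transversals, adjOnly, adjBoth, adjNone, Set.mem_union, Set.mem_insert_iff,
      Set.mem_singleton_iff, Set.mem_ofPred_eq, Set.mem_univ, true_iff]
    tauto
  have hba := h.nadj_ab
  have hca := h.nadj_ac
  have hcb := h.nadj_bc
  have h3 : ({a, b, c} : Set α).encard = 3 :=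
    Set.encard_eq_three.2 ⟨a, b, c, h.ne_ab, h.ne_ac, h.ne_bc, rfl⟩
  have o1 := h.encard_adjOnly hG
  have o2 := h.rotate.encard_adjOnly hG
  have o3 := h.rotate.rotate.encard_adjOnly hG
  have t2 : G.transversals b c a = G.transversals a b c := by
    ext; simp only [transversals, Set.mem_ofPred_eq]; tauto
  have t3 : G.transversals c a b = G.transversals a b c := by
    ext; simp only [transversals, Set.mem_ofPred_eq]; tauto
  have b1 := h.encard_adjBoth hG
  have b2 := h.swap.encard_adjBoth hG
  rw [G.adjBoth_comm b a, b1] at b2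
  rw [G.adjBoth_comm a c] at b1 b2
  rw [hu, Set.encard_union_eq, Set.encard_union_eq, Set.encard_union_eq, Set.encard_union_eq,
    Set.encard_union_eq, Set.encard_union_eq, Set.encard_union_eq, Set.encard_union_eq, h3, o1,
    o2, o3, t2, t3, ← b2, b1]
  · ring
  all_goals
    rw [Set.disjoint_left]
    simp only [transversals, adjOnly, adjBoth, adjNone, Set.mem_union, Set.mem_insert_iff,
      Set.mem_singleton_iff, Set.mem_ofPred_eq]
    grind

theorem encard_univ_mem (hG : G.IsTritangent) (h : G.SkewTriple a b c)
    (hT : ∀ a b c m m', G.SkewTriple a b c → m ∈ G.transversals a b c →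
      m' ∈ G.transversals a b c → m ≠ m' →
      ∃ m'', m ≠ m'' ∧ m' ≠ m'' ∧ G.transversals a b c = {m, m', m''})
    (hN : ∀ n ∈ G.adjNone a b c, (∃ m, G.transversals a b c = {m} ∧ ¬ G.Adj n m) ∨
      ∃ m ∈ G.transversals a b c, ∃ m' ∈ G.transversals a b c,
        m ≠ m' ∧ G.Adj n m ∧ G.Adj n m') :
    (Set.univ : Set α).encard ∈ ({3, 7, 9, 15, 27} : Set ℕ∞) := by
  have hu := h.encard_univ hG
  have hB : (G.adjBoth a b c).encard = 0 ∨ (G.adjBoth a b c).encard = 2 := by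
    rcases Set.eq_empty_or_nonempty (G.adjBoth a b c) with e | e
    · left; rw [e, Set.encard_empty]
    · right; exact h.encard_adjBoth_of_nonempty hG e
  rcases Set.eq_empty_or_nonempty (G.transversals a b c) with hr | ⟨m₁, h₁⟩
  · have hZ : G.adjNone a b c = ∅ := by
      refine Set.eq_empty_of_forall_notMem fun n hn => ?_
      rcases hN n hn with ⟨m, hm, -⟩ | ⟨m, hm, -⟩
      · simp [hr] at hm
      · simp [hr] at hm
    rw [hr, hZ] at hu
    rcases hB with e | e <;> rw [hu, e] <;> norm_num
  by_cases hr : G.transversals a b c = {m₁}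
  · have hZ := h.encard_adjNone_eq_adjBoth hG h₁ (by
      intro n hn
      rcases hN n hn with ⟨m, hm, hnm⟩ | ⟨m, hm, m', hm', hne, -⟩
      · rw [hm] at h₁
        rwa [Set.mem_singleton_iff.1 h₁]
      · rw [hr] at hm hm'
        exact absurd ((Set.mem_singleton_iff.1 hm).trans (Set.mem_singleton_iff.1 hm').symm) hne)
    rw [hr, hZ, Set.encard_singleton] at hu
    rcases hB with e | e <;> rw [hu, e] <;> norm_num
  obtain ⟨m₂, h₂, h₁₂⟩ : ∃ m₂ ∈ G.transversals a b c, m₁ ≠ m₂ := by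
    by_contra! H
    exact hr (Set.eq_singleton_iff_unique_mem.2 ⟨h₁, fun x hx => (H x hx).symm⟩)
  obtain ⟨m₃, h₁₃, h₂₃, hT₃⟩ := hT a b c m₁ m₂ h h₁ h₂ h₁₂
  have h₃ : m₃ ∈ G.transversals a b c := by rw [hT₃]; simp
  have hM := h.of_transversals hG h₁ h₂ h₃ h₁₂ h₁₃ h₂₃
  have ha : a ∈ G.transversals m₁ m₂ m₃ := ⟨h₁.1.symm, h₂.1.symm, h₃.1.symm⟩
  have hb : b ∈ G.transversals m₁ m₂ m₃ := ⟨h₁.2.1.symm, h₂.2.1.symm, h₃.2.1.symm⟩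
  have hc : c ∈ G.transversals m₁ m₂ m₃ := ⟨h₁.2.2.symm, h₂.2.2.symm, h₃.2.2.symm⟩
  have hTM : G.transversals m₁ m₂ m₃ = {a, b, c} := by
    obtain ⟨c', hac, hbc, e⟩ := hT _ _ _ a b hM ha hb h.ne_ab
    have hc' := hc
    rw [e] at hc'
    rcases hc' with e' | e' | e'
    · exact absurd e'.symm h.ne_ac
    · exact absurd e'.symm h.ne_bc
    · rw [e, Set.mem_singleton_iff.1 e']
  have hZ : G.adjNone a b c = G.adjBoth m₁ m₂ m₃ ∪ (G.adjBoth m₁ m₃ m₂ ∪ G.adjBoth m₂ m₃ m₁) := by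
    refine Set.Subset.antisymm (fun n hn => ?_) ?_
    · have hnot : n ∉ G.transversals m₁ m₂ m₃ := by
        rw [hTM]
        rintro (e | e | e)
        exacts [hn.1.1 e, hn.1.2.1 e, hn.1.2.2 e]
      rcases hN n hn with ⟨m, hm, -⟩ | ⟨m, hm, m', hm', hne, hnm, hnm'⟩
      · rw [hm] at h₁ h₂
        exact absurd ((Set.mem_singleton_iff.1 h₁).trans (Set.mem_singleton_iff.1 h₂).symm) h₁₂
      · rw [hT₃] at hm hm'
        simp only [transversals, adjBoth, Set.mem_union, Set.mem_insert_iff,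
          Set.mem_singleton_iff, Set.mem_ofPred_eq] at hm hm' hnot ⊢
        grind
    · have key : ∀ m₁ m₂ m₃, G.SkewTriple m₁ m₂ m₃ → G.transversals m₁ m₂ m₃ = {a, b, c} →
          G.adjBoth m₁ m₂ m₃ ⊆ G.adjNone a b c := by
        intro m₁ m₂ m₃ hM hTM n hn
        have hx : ∀ x ∈ G.transversals m₁ m₂ m₃, n ≠ x ∧ ¬ G.Adj n x := fun x hx =>
          ⟨fun e => hn.2.2 (e ▸ hx.2.2), hM.not_adj_of_mem_adjBoth hG hn hx⟩
        have ha := hx a (by simp [hTM])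
        have hb := hx b (by simp [hTM])
        have hc := hx c (by simp [hTM])
        exact ⟨⟨ha.1, hb.1, hc.1⟩, ha.2, hb.2, hc.2⟩
      refine Set.union_subset (key _ _ _ hM hTM) (Set.union_subset
        (key _ _ _ hM.rotate.rotate.swap ?_) (key _ _ _ hM.rotate ?_))
      all_goals
        rw [← hTM]; ext; simp only [transversals, Set.mem_ofPred_eq]; tauto
  have hZc : (G.adjNone a b c).encard = 3 * (G.adjBoth m₁ m₂ m₃).encard := by
    have b1 := hM.encard_adjBoth hG
    have b2 := hM.swap.encard_adjBoth hG
    rw [G.adjBoth_comm m₂ m₁, b1] at b2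
    rw [hZ, Set.encard_union_eq, Set.encard_union_eq, ← b2, b1]
    · ring
    all_goals
      rw [Set.disjoint_left]
      simp only [adjBoth, Set.mem_union, Set.mem_ofPred_eq]
      tauto
  have hT3 : (G.transversals a b c).encard = 3 :=
    Set.encard_eq_three.2 ⟨m₁, m₂, m₃, h₁₂, h₁₃, h₂₃, hT₃⟩
  rw [hZc, hT3] at hu
  rcases Set.eq_empty_or_nonempty (G.adjBoth a b c) with e | e
  · have : G.adjBoth m₁ m₂ m₃ = ∅ := by
      by_contra hne
      have := hM.adjBoth_nonempty_of_adjBoth hG hc ha hb h.ne_ac.symm h.ne_bc.symm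
        (Set.nonempty_iff_ne_empty.2 hne)
      exact this.ne_empty e
    rw [this, e] at hu
    rw [hu]; norm_num
  · have := hM.encard_adjBoth_of_nonempty hG
      (h.adjBoth_nonempty_of_adjBoth hG h₃ h₁ h₂ h₁₃.symm h₂₃.symm e)
    rw [this, h.encard_adjBoth_of_nonempty hG e] at hu
    rw [hu]; norm_num

end SkewTriple
end SimpleGraph

section Geometry

open Module Submodule

section LinearAlgebra

variable {k V : Type*} [Field k] [AddCommGroup V] [Module k V]

lemma finrank_span_pair_eq_two {x y : V} (h : LinearIndependent k ![x, y]) :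
    finrank k (span k {x, y}) = 2 := by
  rw [← Matrix.range_cons_cons_empty x y ![], finrank_span_eq_card h, Fintype.card_fin]

lemma Submodule.eq_of_finrank_eq_two {W W' : Submodule k V} (hW : finrank k W = 2)
    (hW' : finrank k W' = 2) (h : W ≤ W') : W = W' := by
  have : FiniteDimensional k W' := FiniteDimensional.of_finrank_pos (by omega)
  exact eq_of_le_of_finrank_eq h (by omega)

lemma Submodule.eq_span_pair_of_finrank_eq_two {W : Submodule k V} (hW : finrank k W = 2) {x y : V}
    (hx : x ∈ W) (hy : y ∈ W) (h : LinearIndependent k ![x, y]) : W = span k {x, y} := by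
  refine (eq_of_finrank_eq_two (finrank_span_pair_eq_two h) hW ?_).symm
  rw [span_le]
  rintro _ (rfl | rfl)
  exacts [hx, hy]

lemma Submodule.exists_linearIndependent_pair {W : Submodule k V} (hW : finrank k W = 2) {x : V}
    (h0 : x ≠ 0) : ∃ y ∈ W, LinearIndependent k ![x, y] := by
  have : FiniteDimensional k W := FiniteDimensional.of_finrank_pos (by omega)
  by_contra! H
  have hle : W ≤ span k {x} := by
    intro y hy
    have := H y hy
    rw [LinearIndependent.pair_iff' h0] at this
    push Not at this
    exact mem_span_singleton.2 this
  have := finrank_mono hle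
  rw [finrank_span_singleton h0] at this
  omega

lemma Submodule.exists_mem_ne_zero_of_finrank_eq_two {W : Submodule k V} (hW : finrank k W = 2) :
    ∃ x ∈ W, x ≠ 0 :=
  W.ne_bot_iff.1 (by rintro rfl; simp at hW)

lemma Submodule.finrank_sup_eq_three [FiniteDimensional k V] {W W' : Submodule k V}
    (hW : finrank k W = 2) (hW' : finrank k W' = 2) (hne : W ≠ W') (h : W ⊓ W' ≠ ⊥) :
    finrank k (W ⊔ W' : Submodule k V) = 3 := by
  have h1 := finrank_sup_add_finrank_inf_eq W W'
  have h2 : finrank k (W ⊓ W' : Submodule k V) ≠ 0 := by rwa [Ne, finrank_eq_zero]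
  have h3 : finrank k (W ⊓ W' : Submodule k V) < finrank k W :=
    finrank_lt_finrank_of_lt (lt_of_le_of_ne inf_le_left fun e =>
      hne (eq_of_finrank_eq_two hW hW' (e ▸ inf_le_right)))
  omega

lemma Submodule.inf_ne_bot_of_finrank [FiniteDimensional k V] {W W' P : Submodule k V}
    (hW : W ≤ P) (hW' : W' ≤ P) (h : finrank k P < finrank k W + finrank k W') :
    W ⊓ W' ≠ ⊥ := by
  intro e
  have h1 := finrank_sup_add_finrank_inf_eq W W'
  rw [e, finrank_bot] at h1
  have := finrank_mono (sup_le hW hW')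
  omega

end LinearAlgebra

namespace CubicForm

variable {k V : Type*} [Field k] [AddCommGroup V] [Module k V]

/-- A symmetric trilinear form `Φ` whose cubic form `Φ x x x` has no singular rational point, and
for which no tangent plane is constant along a line of the surface. -/
structure IsSmooth (Φ : V →ₗ[k] V →ₗ[k] V →ₗ[k] k) : Prop where
  swap₁₂ : ∀ x y z, Φ x y z = Φ y x z
  swap₂₃ : ∀ x y z, Φ x y z = Φ x z y
  point : ∀ x, x ≠ 0 → ∃ y, Φ x x y ≠ 0
  plane : ∀ W P : Submodule k V, finrank k W = 2 → finrank k P = 3 →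
    ∃ x ∈ W, ∃ y ∈ W, ∃ z ∈ P, Φ x y z ≠ 0

/-- `W` is a line on the cubic surface `Φ x x x = 0`. -/
def IsLine (Φ : V →ₗ[k] V →ₗ[k] V →ₗ[k] k) (W : Submodule k V) : Prop :=
  finrank k W = 2 ∧ ∀ x ∈ W, ∀ y ∈ W, ∀ z ∈ W, Φ x y z = 0

variable {Φ : V →ₗ[k] V →ₗ[k] V →ₗ[k] k}

lemma IsSmooth.swap₁₃ (hΦ : IsSmooth Φ) (x y z : V) : Φ x y z = Φ z y x := by
  rw [hΦ.swap₁₂, hΦ.swap₂₃, hΦ.swap₁₂]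

lemma IsSmooth.isLine_span_pair (hΦ : IsSmooth Φ) {x y : V} (h : LinearIndependent k ![x, y])
    (h₀ : Φ x x x = 0) (h₁ : Φ x x y = 0) (h₂ : Φ x y y = 0) (h₃ : Φ y y y = 0) :
    IsLine Φ (span k {x, y}) := by
  refine ⟨finrank_span_pair_eq_two h, fun u hu v hv w hw => ?_⟩
  obtain ⟨a, b, rfl⟩ := mem_span_pair.1 hu
  obtain ⟨c, d, rfl⟩ := mem_span_pair.1 hv
  obtain ⟨e, f, rfl⟩ := mem_span_pair.1 hw
  have h₁' : Φ x y x = 0 := by rw [hΦ.swap₂₃, h₁]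
  have h₁'' : Φ y x x = 0 := by rw [hΦ.swap₁₂, h₁']
  have h₂' : Φ y x y = 0 := by rw [hΦ.swap₁₂, h₂]
  have h₂'' : Φ y y x = 0 := by rw [hΦ.swap₂₃, h₂']
  simp [h₀, h₁, h₂, h₃, h₁', h₁'', h₂', h₂'']

/-- The plane section by `P` of the cubic surface consists of the lines `W₁, W₂, W₃`. -/
structure IsTritangentPlane (Φ : V →ₗ[k] V →ₗ[k] V →ₗ[k] k) (P W₁ W₂ W₃ : Submodule k V) :
    Prop where
  finrank_eq : finrank k P = 3
  line₁ : IsLine Φ W₁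
  line₂ : IsLine Φ W₂
  line₃ : IsLine Φ W₃
  le₁ : W₁ ≤ P
  le₂ : W₂ ≤ P
  le₃ : W₃ ≤ P
  ne₁₂ : W₁ ≠ W₂
  ne₁₃ : W₁ ≠ W₃
  ne₂₃ : W₂ ≠ W₃
  mem_or : ∀ x ∈ P, Φ x x x = 0 → x ∈ W₁ ∨ x ∈ W₂ ∨ x ∈ W₃

namespace IsTritangentPlane

variable {P W₁ W₂ W₃ N : Submodule k V}

lemma rotate (h : IsTritangentPlane Φ P W₁ W₂ W₃) : IsTritangentPlane Φ P W₂ W₃ W₁ :=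
  ⟨h.1, h.3, h.4, h.2, h.6, h.7, h.5, h.10, h.8.symm, h.9.symm, fun x hx h0 => by
    have := h.mem_or x hx h0; tauto⟩

lemma eq_of_le [Infinite k] (h : IsTritangentPlane Φ P W₁ W₂ W₃) (hN : IsLine Φ N) (hNP : N ≤ P) :
    N = W₁ ∨ N = W₂ ∨ N = W₃ := by
  have hc : ⋃ i, ((![W₁, W₂, W₃] i).comap N.subtype : Set N) = Set.univ := by
    refine Set.eq_univ_of_forall fun x => ?_
    rcases h.mem_or x (hNP x.2) (hN.2 _ x.2 _ x.2 _ x.2) with hx | hx | hx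
    · exact Set.mem_iUnion.2 ⟨0, hx⟩
    · exact Set.mem_iUnion.2 ⟨1, hx⟩
    · exact Set.mem_iUnion.2 ⟨2, hx⟩
  obtain ⟨i, hi⟩ := Subspace.exists_eq_top_of_iUnion_eq_univ hc
  rw [comap_subtype_eq_top] at hi
  fin_cases i
  · exact Or.inl (eq_of_finrank_eq_two hN.1 h.line₁.1 hi)
  · exact Or.inr (Or.inl (eq_of_finrank_eq_two hN.1 h.line₂.1 hi))
  · exact Or.inr (Or.inr (eq_of_finrank_eq_two hN.1 h.line₃.1 hi))

variable [FiniteDimensional k V]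

lemma sup_eq (h : IsTritangentPlane Φ P W₁ W₂ W₃) : W₁ ⊔ W₂ = P := by
  refine eq_of_le_of_finrank_eq (sup_le h.le₁ h.le₂) ?_
  rw [h.finrank_eq]
  refine finrank_sup_eq_three h.line₁.1 h.line₂.1 h.ne₁₂
    (inf_ne_bot_of_finrank h.le₁ h.le₂ ?_)
  rw [h.line₁.1, h.line₂.1, h.finrank_eq]; norm_num

lemma meets (h : IsTritangentPlane Φ P W₁ W₂ W₃) (hV : finrank k V = 4) (hN : IsLine Φ N) :
    N ⊓ W₁ ≠ ⊥ ∨ N ⊓ W₂ ≠ ⊥ ∨ N ⊓ W₃ ≠ ⊥ := by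
  have : N ⊓ P ≠ ⊥ := inf_ne_bot_of_finrank le_top le_top (by
    rw [finrank_top, hV, hN.1, h.finrank_eq]; norm_num)
  obtain ⟨x, hx, hx0⟩ := (Submodule.ne_bot_iff _).1 this
  simp only [Submodule.ne_bot_iff]
  rcases h.mem_or x hx.2 (hN.2 x hx.1 x hx.1 x hx.1) with h | h | h
  · exact Or.inl ⟨x, ⟨hx.1, h⟩, hx0⟩
  · exact Or.inr (Or.inl ⟨x, ⟨hx.1, h⟩, hx0⟩)
  · exact Or.inr (Or.inr ⟨x, ⟨hx.1, h⟩, hx0⟩)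

lemma le_of_meets (h : IsTritangentPlane Φ P W₁ W₂ W₃) (hΦ : IsSmooth Φ) (hV : finrank k V = 4)
    (hN : IsLine Φ N) (h₁ : N ⊓ W₁ ≠ ⊥) (h₂ : N ⊓ W₂ ≠ ⊥) : N ≤ P := by
  obtain ⟨x, hx, hx0⟩ := (Submodule.ne_bot_iff _).1 h₁
  obtain ⟨y, hy, hy0⟩ := (Submodule.ne_bot_iff _).1 h₂
  by_cases hxy : LinearIndependent k ![x, y]
  · rw [eq_span_pair_of_finrank_eq_two hN.1 hx.1 hy.1 hxy, span_le]
    rintro _ (rfl | rfl)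
    exacts [h.le₁ hx.2, h.le₂ hy.2]
  · rw [LinearIndependent.pair_iff' hx0] at hxy
    push Not at hxy
    obtain ⟨c, rfl⟩ := hxy
    have hc : c ≠ 0 := by rintro rfl; simp at hy0
    have hx2 : x ∈ W₂ := by simpa [hc] using W₂.smul_mem c⁻¹ hy.2
    have hker : ∀ W, IsLine Φ W → x ∈ W → W ≤ LinearMap.ker (Φ x x) := fun W hW hxW z hz =>
      hW.2 x hxW x hxW z hz
    obtain ⟨z, hz⟩ := hΦ.point x hx0
    have hlt : finrank k (LinearMap.ker (Φ x x)) < 4 := by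
      rw [← hV]
      exact finrank_lt fun e => hz (by
        have : z ∈ LinearMap.ker (Φ x x) := e ▸ mem_top
        exact this)
    have : P = LinearMap.ker (Φ x x) := by
      refine eq_of_le_of_finrank_le ?_ ?_
      · rw [← h.sup_eq]
        exact sup_le (hker _ h.line₁ hx.2) (hker _ h.line₂ hx2)
      · rw [h.finrank_eq]; omega
    rw [this]
    exact hker _ hN hx.1

lemma not_meets [Infinite k] (h : IsTritangentPlane Φ P W₁ W₂ W₃) (hΦ : IsSmooth Φ)
    (hV : finrank k V = 4) (hN : IsLine Φ N) (hn₁ : N ≠ W₁) (hn₂ : N ≠ W₂) (hn₃ : N ≠ W₃) :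
    ¬ (N ⊓ W₁ ≠ ⊥ ∧ N ⊓ W₂ ≠ ⊥) := fun hm => by
  have := h.eq_of_le hN (h.le_of_meets hΦ hV hN hm.1 hm.2)
  tauto

end IsTritangentPlane

end CubicForm

namespace CubicForm

variable {k V : Type*} [Field k] [AddCommGroup V] [Module k V]
  {Φ : V →ₗ[k] V →ₗ[k] V →ₗ[k] k} {W₁ W₂ W₃ N : Submodule k V}

/-- Two distinct meeting lines span a plane with a frame adapted to them. -/
lemma exists_frame (h₁ : finrank k W₁ = 2) (h₂ : finrank k W₂ = 2) (hne : W₁ ≠ W₂)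
    (hm : W₁ ⊓ W₂ ≠ ⊥) : ∃ p a b : V, W₁ = span k {p, a} ∧ W₂ = span k {p, b} ∧
      (∀ x y z : k, x • p + y • a + z • b = 0 → x = 0 ∧ y = 0 ∧ z = 0) ∧
      ∀ v ∈ W₁ ⊔ W₂, ∃ x y z : k, x • p + y • a + z • b = v := by
  obtain ⟨p, hp, hp0⟩ := (Submodule.ne_bot_iff _).1 hm
  obtain ⟨a, ha, hpa⟩ := exists_linearIndependent_pair h₁ hp0
  obtain ⟨b, hb, hpb⟩ := exists_linearIndependent_pair h₂ hp0
  have e₁ := eq_span_pair_of_finrank_eq_two h₁ hp.1 ha hpa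
  have e₂ := eq_span_pair_of_finrank_eq_two h₂ hp.2 hb hpb
  refine ⟨p, a, b, e₁, e₂, ?_, ?_⟩
  · intro x y z h
    have hz : z = 0 := by
      by_contra hz
      refine hne (eq_of_finrank_eq_two h₂ h₁ ?_).symm
      have hb' : b = (-z⁻¹ * x) • p + (-z⁻¹ * y) • a := by
        have : z⁻¹ • (x • p + y • a + z • b) = 0 := by rw [h, smul_zero]
        rw [smul_add, smul_smul, inv_mul_cancel₀ hz, one_smul] at this
        rw [← sub_eq_zero, ← this]
        module
      rw [e₂, span_le]
      rintro _ (rfl | rfl)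
      · exact hp.1
      · rw [hb']
        exact add_mem (smul_mem _ _ hp.1) (smul_mem _ _ ha)
    subst hz
    rw [zero_smul, add_zero] at h
    have := LinearIndependent.pair_iff.1 hpa x y h
    exact ⟨this.1, this.2, rfl⟩
  · intro v hv
    obtain ⟨u, hu, w, hw, rfl⟩ := mem_sup.1 hv
    rw [e₁] at hu
    rw [e₂] at hw
    obtain ⟨r, s, rfl⟩ := mem_span_pair.1 hu
    obtain ⟨r', s', rfl⟩ := mem_span_pair.1 hw
    exact ⟨r + r', s, s', by module⟩

lemma IsSmooth.apply_cube (hΦ : IsSmooth Φ) (p a b : V) (x y z : k) :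
    Φ (x • p + y • a + z • b) (x • p + y • a + z • b) (x • p + y • a + z • b) =
      x ^ 3 * Φ p p p + y ^ 3 * Φ a a a + z ^ 3 * Φ b b b + 3 * (x ^ 2 * y * Φ p p a +
      x ^ 2 * z * Φ p p b + x * y ^ 2 * Φ p a a + x * z ^ 2 * Φ p b b + y ^ 2 * z * Φ a a b +
      y * z ^ 2 * Φ a b b + 2 * x * y * z * Φ p a b) := by
  simp only [map_add, map_smul, LinearMap.add_apply, LinearMap.smul_apply, smul_eq_mul]
  rw [hΦ.swap₁₂ a p p, hΦ.swap₁₂ b p p, hΦ.swap₁₂ a p a, hΦ.swap₁₂ b p b, hΦ.swap₁₂ a p b,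
    hΦ.swap₁₂ b p a, hΦ.swap₁₂ b a a, hΦ.swap₁₂ b a b, hΦ.swap₁₂ b a p, hΦ.swap₂₃ p a p,
    hΦ.swap₂₃ p b p, hΦ.swap₂₃ p b a, hΦ.swap₂₃ a b p, hΦ.swap₂₃ a a p, hΦ.swap₂₃ b b p,
    hΦ.swap₂₃ b b a, hΦ.swap₂₃ a b a, hΦ.swap₁₂ a p b, hΦ.swap₁₂ a p a, hΦ.swap₁₂ b p b,
    hΦ.swap₁₂ b a b]
  ring

/-- In a plane containing the line spanned by `p` and `a`, the surface does not touch the plane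
all along this line. -/
lemma IsSmooth.not_double (hΦ : IsSmooth Φ) {p a b : V} {P : Submodule k V} (hP : finrank k P = 3)
    (hpa : IsLine Φ (span k {p, a})) (hb : ∀ v ∈ P, ∃ x y z : k, x • p + y • a + z • b = v)
    (hpp : Φ p p b = 0) : Φ a a b ≠ 0 ∨ Φ p a b ≠ 0 := by
  by_contra! H
  obtain ⟨x, hx, y, hy, z, hz, hne⟩ := hΦ.plane _ P hpa.1 hP
  obtain ⟨r, s, t, rfl⟩ := hb z hz
  apply hne
  have hp : p ∈ span k {p, a} := subset_span (by simp)
  have ha : a ∈ span k {p, a} := subset_span (by simp)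
  have e : Φ x y (r • p + s • a + t • b) = t * Φ x y b := by
    rw [map_add, map_add, map_smul, map_smul, hpa.2 x hx y hy p hp, hpa.2 x hx y hy a ha,
      map_smul, smul_zero, smul_zero, zero_add, zero_add, smul_eq_mul]
  obtain ⟨c, d, rfl⟩ := mem_span_pair.1 hx
  obtain ⟨c', d', rfl⟩ := mem_span_pair.1 hy
  rw [e]
  have hap : Φ a p b = 0 := by rw [hΦ.swap₁₂, H.2]
  simp [H.1, H.2, hpp, hap]

/-- The residual line of the plane section of a frame, where the three lines are concurrent. -/
lemma IsSmooth.exists_residual_of_eq_zero (hΦ : IsSmooth Φ) {p a b : V}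
    (hind : ∀ x y z : k, x • p + y • a + z • b = 0 → x = 0 ∧ y = 0 ∧ z = 0)
    (hpa : IsLine Φ (span k {p, a})) (hpb : IsLine Φ (span k {p, b})) (hγ : Φ p a b = 0)
    (hα : Φ a a b ≠ 0) (hβ : Φ a b b ≠ 0) :
    ∃ W, IsLine Φ W ∧ W ≤ span k {p, a} ⊔ span k {p, b} ∧ span k {p, a} ≠ W ∧
      span k {p, b} ≠ W ∧ ∀ x y z : k, y * Φ a a b + z * Φ a b b + 2 * x * Φ p a b = 0 →
        x • p + y • a + z • b ∈ W := by
  have hp : p ∈ span k {p, a} := subset_span (by simp)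
  have ha : a ∈ span k {p, a} := subset_span (by simp)
  have hp' : p ∈ span k {p, b} := subset_span (by simp)
  have hb : b ∈ span k {p, b} := subset_span (by simp)
  have v := hΦ.apply_cube p a b
  have ppp := hpa.2 p hp p hp p hp
  have ppa := hpa.2 p hp p hp a ha
  have paa := hpa.2 p hp a ha a ha
  have aaa := hpa.2 a ha a ha a ha
  have ppb := hpb.2 p hp' p hp' b hb
  have pbb := hpb.2 p hp' b hb b hb
  have bbb := hpb.2 b hb b hb b hb
  have hi : LinearIndependent k ![p, Φ a b b • a - Φ a a b • b] := by
    rw [LinearIndependent.pair_iff]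
    intro s t h
    have := hind s (t * Φ a b b) (-t * Φ a a b) (by rw [← h]; module)
    exact ⟨this.1, (mul_eq_zero.1 this.2.1).resolve_right hβ⟩
  have hmem : Φ a b b • a - Φ a a b • b ∈ span k {p, Φ a b b • a - Φ a a b • b} :=
    subset_span (by simp)
  have pba : Φ p b a = 0 := by rw [hΦ.swap₂₃, hγ]
  refine ⟨span k {p, Φ a b b • a - Φ a a b • b}, hΦ.isLine_span_pair hi ppp ?_ ?_ ?_, ?_, ?_, ?_,
    ?_⟩
  · simp [ppa, ppb]
  · simp [paa, hγ, pba, pbb]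
  · have := v 0 (Φ a b b) (- Φ a a b)
    rw [zero_smul, zero_add, neg_smul, ← sub_eq_add_neg] at this
    rw [this, aaa, bbb]
    ring
  · rw [span_le]
    rintro _ (rfl | rfl)
    · exact mem_sup_left hp
    · exact sub_mem (smul_mem _ _ (mem_sup_left ha)) (smul_mem _ _ (mem_sup_right hb))
  · intro e
    rw [← e] at hmem
    obtain ⟨s, t, h⟩ := mem_span_pair.1 hmem
    have := hind s (t - Φ a b b) (Φ a a b) (by rw [← sub_eq_zero] at h; rw [← h]; module)
    exact hα this.2.2
  · intro e
    rw [← e] at hmem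
    obtain ⟨s, t, h⟩ := mem_span_pair.1 hmem
    have := hind s (- Φ a b b) (t + Φ a a b) (by rw [← sub_eq_zero] at h; rw [← h]; module)
    exact hβ (neg_eq_zero.1 this.2.1)
  · intro x y z h
    refine mem_span_pair.2 ⟨x, y / Φ a b b, ?_⟩
    have hz : z = - (y / Φ a b b * Φ a a b) := by
      field_simp
      rw [hγ] at h
      linear_combination h
    rw [smul_sub, smul_smul, smul_smul, div_mul_cancel₀ _ hβ, hz]
    module

/-- The residual line of the plane section of a frame, where the three lines form a triangle. -/
lemma IsSmooth.exists_residual_of_ne_zero [CharZero k] (hΦ : IsSmooth Φ) {p a b : V}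
    (hind : ∀ x y z : k, x • p + y • a + z • b = 0 → x = 0 ∧ y = 0 ∧ z = 0)
    (hpa : IsLine Φ (span k {p, a})) (hpb : IsLine Φ (span k {p, b})) (hγ : Φ p a b ≠ 0) :
    ∃ W, IsLine Φ W ∧ W ≤ span k {p, a} ⊔ span k {p, b} ∧ span k {p, a} ≠ W ∧
      span k {p, b} ≠ W ∧ ∀ x y z : k, y * Φ a a b + z * Φ a b b + 2 * x * Φ p a b = 0 →
        x • p + y • a + z • b ∈ W := by
  have hp : p ∈ span k {p, a} := subset_span (by simp)
  have ha : a ∈ span k {p, a} := subset_span (by simp)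
  have hp' : p ∈ span k {p, b} := subset_span (by simp)
  have hb : b ∈ span k {p, b} := subset_span (by simp)
  set u := (2 * Φ p a b) • a - Φ a a b • p with hu
  set w := (2 * Φ p a b) • b - Φ a b b • p with hw
  have hua : u ∈ span k {p, a} := sub_mem (smul_mem _ _ ha) (smul_mem _ _ hp)
  have hwb : w ∈ span k {p, b} := sub_mem (smul_mem _ _ hb) (smul_mem _ _ hp')
  have hi : LinearIndependent k ![u, w] := by
    rw [LinearIndependent.pair_iff]
    intro s t h
    have := hind (- (s * Φ a a b) - t * Φ a b b) (2 * s * Φ p a b) (2 * t * Φ p a b)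
      (by rw [← h, hu, hw]; module)
    exact ⟨by simpa [hγ] using this.2.1, by simpa [hγ] using this.2.2⟩
  have huW : u ∈ span k {u, w} := subset_span (by simp)
  have hwW : w ∈ span k {u, w} := subset_span (by simp)
  refine ⟨span k {u, w}, hΦ.isLine_span_pair hi (hpa.2 u hua u hua u hua) ?_ ?_
    (hpb.2 w hwb w hwb w hwb), ?_, ?_, ?_, ?_⟩
  · have h1 : Φ u u p = 0 := hpa.2 u hua u hua p hp
    have ppb := hpb.2 p hp' p hp' b hb
    have apb := hΦ.swap₁₂ a p b
    have h2 : Φ u u b = 0 := by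
      simp only [hu, map_sub, map_smul, LinearMap.sub_apply, LinearMap.smul_apply, smul_eq_mul,
        ppb, apb]
      ring
    simp [hw, h1, h2]
  · have h1 : Φ p w w = 0 := hpb.2 p hp' w hwb w hwb
    have ppa := hpa.2 p hp p hp a ha
    have app : Φ a p p = 0 := by rw [hΦ.swap₁₃, ppa]
    have abp : Φ a b p = Φ p a b := by rw [hΦ.swap₂₃, hΦ.swap₁₂]
    have apb := hΦ.swap₁₂ a p b
    have h2 : Φ a w w = 0 := by
      simp only [hw, map_sub, map_smul, LinearMap.sub_apply, LinearMap.smul_apply, smul_eq_mul,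
        app, abp, apb]
      ring
    simp [hu, h1, h2]
  · rw [span_le]
    rintro _ (rfl | rfl)
    · exact mem_sup_left hua
    · exact mem_sup_right hwb
  · intro e
    rw [← e] at hwW
    obtain ⟨s, t, h⟩ := mem_span_pair.1 hwW
    have := hind (s + Φ a b b) t (- (2 * Φ p a b))
      (by rw [← sub_eq_zero] at h; rw [← h, hw]; module)
    simp [hγ] at this
  · intro e
    rw [← e] at huW
    obtain ⟨s, t, h⟩ := mem_span_pair.1 huW
    have := hind (s + Φ a a b) (- (2 * Φ p a b)) t
      (by rw [← sub_eq_zero] at h; rw [← h, hu]; module)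
    simp [hγ] at this
  · intro x y z h
    refine mem_span_pair.2 ⟨y / (2 * Φ p a b), z / (2 * Φ p a b), ?_⟩
    have hx : x = - (y / (2 * Φ p a b) * Φ a a b + z / (2 * Φ p a b) * Φ a b b) := by
      field_simp
      linear_combination h
    have hy : y / (2 * Φ p a b) * (2 * Φ p a b) = y := by field_simp
    have hz : z / (2 * Φ p a b) * (2 * Φ p a b) = z := by field_simp
    rw [hx, hu, hw, smul_sub, smul_sub, smul_smul _ _ a, smul_smul _ _ b, hy, hz]
    module

lemma IsLine.exists_tritangentPlane [CharZero k] [FiniteDimensional k V] (hΦ : IsSmooth Φ)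
    (h₁ : IsLine Φ W₁) (h₂ : IsLine Φ W₂) (hne : W₁ ≠ W₂) (hm : W₁ ⊓ W₂ ≠ ⊥) :
    ∃ W₃, IsTritangentPlane Φ (W₁ ⊔ W₂) W₁ W₂ W₃ := by
  have hP3 := finrank_sup_eq_three h₁.1 h₂.1 hne hm
  obtain ⟨p, a, b, rfl, rfl, hind, hP⟩ := exists_frame h₁.1 h₂.1 hne hm
  have hp : p ∈ span k {p, a} := subset_span (by simp)
  have ha : a ∈ span k {p, a} := subset_span (by simp)
  have hp' : p ∈ span k {p, b} := subset_span (by simp)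
  have hb : b ∈ span k {p, b} := subset_span (by simp)
  have hα := hΦ.not_double hP3 h₁ hP (h₂.2 p hp' p hp' b hb)
  have hβ := hΦ.not_double hP3 h₂ (b := a) (fun v hv => by
    obtain ⟨x, y, z, rfl⟩ := hP v hv
    exact ⟨x, z, y, by module⟩) (h₁.2 p hp p hp a ha)
  rw [hΦ.swap₁₃ b b a, hΦ.swap₂₃ p b a] at hβ
  obtain ⟨W₃, h₃, hle, hne₁, hne₂, h⟩ : ∃ W, IsLine Φ W ∧ W ≤ span k {p, a} ⊔ span k {p, b} ∧
      span k {p, a} ≠ W ∧ span k {p, b} ≠ W ∧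
      ∀ x y z : k, y * Φ a a b + z * Φ a b b + 2 * x * Φ p a b = 0 →
        x • p + y • a + z • b ∈ W := by
    by_cases h0 : Φ p a b = 0
    · exact hΦ.exists_residual_of_eq_zero hind h₁ h₂ h0 (hα.resolve_right (not_not.2 h0))
        (hβ.resolve_right (not_not.2 h0))
    · exact hΦ.exists_residual_of_ne_zero hind h₁ h₂ h0
  refine ⟨W₃, hP3, h₁, h₂, h₃, le_sup_left, le_sup_right, hle, hne, hne₁, hne₂, ?_⟩
  intro v hv hv0
  obtain ⟨x, y, z, rfl⟩ := hP v hv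
  have hF : 3 * (y * z * (y * Φ a a b + z * Φ a b b + 2 * x * Φ p a b)) = 0 := by
    rw [← hv0, hΦ.apply_cube, h₁.2 p hp p hp p hp, h₁.2 a ha a ha a ha, h₂.2 b hb b hb b hb,
      h₁.2 p hp p hp a ha, h₂.2 p hp' p hp' b hb, h₁.2 p hp a ha a ha, h₂.2 p hp' b hb b hb]
    ring
  simp only [mul_eq_zero, OfNat.ofNat_ne_zero, false_or] at hF
  rcases hF with (rfl | rfl) | h0
  · right; left
    rw [zero_smul, add_zero]
    exact add_mem (smul_mem _ _ hp') (smul_mem _ _ hb)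
  · left
    rw [zero_smul, add_zero]
    exact add_mem (smul_mem _ _ hp) (smul_mem _ _ ha)
  · exact Or.inr (Or.inr (h x y z h0))

/-- The graph whose vertices are the lines on the surface, two lines being adjacent when they
are distinct and meet. -/
def lineGraph (Φ : V →ₗ[k] V →ₗ[k] V →ₗ[k] k) : SimpleGraph {W : Submodule k V // IsLine Φ W} where
  Adj W W' := W ≠ W' ∧ W.1 ⊓ W'.1 ≠ ⊥
  symm := ⟨fun _ _ h => ⟨h.1.symm, by rw [inf_comm]; exact h.2⟩⟩
  loopless := ⟨fun _ h => h.1 rfl⟩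

lemma lineGraph_isTritangent [CharZero k] [FiniteDimensional k V] (hΦ : IsSmooth Φ)
    (hV : finrank k V = 4) : (lineGraph Φ).IsTritangent := by
  rintro ⟨a, ha⟩ ⟨b, hb⟩ ⟨hne, hm⟩
  rw [Ne, Subtype.mk.injEq] at hne
  obtain ⟨c, h⟩ := ha.exists_tritangentPlane hΦ hb hne hm
  have hmeet : ∀ {W W'}, W ≤ a ⊔ b → W' ≤ a ⊔ b → IsLine Φ W → IsLine Φ W' → W ⊓ W' ≠ ⊥ :=
    fun hW hW' hl hl' => inf_ne_bot_of_finrank hW hW' (by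
      rw [h.finrank_eq, hl.1, hl'.1]; norm_num)
  refine ⟨⟨c, h.line₃⟩, ⟨by simpa using h.ne₁₃, hmeet h.le₁ h.le₃ ha h.line₃⟩,
    ⟨by simpa using h.ne₂₃, hmeet h.le₂ h.le₃ hb h.line₃⟩, ?_⟩
  rintro ⟨d, hd⟩ hda hdb hdc
  have h1 := h.meets hV hd
  simp only [Ne, Subtype.mk.injEq] at hda hdb hdc
  have h2 := h.not_meets hΦ hV hd hda hdb hdc
  have h3 := h.rotate.not_meets hΦ hV hd hdb hdc hda
  have h4 := h.rotate.rotate.not_meets hΦ hV hd hdc hda hdb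
  simp only [lineGraph, Ne, Subtype.mk.injEq, hda, hdb, hdc, not_false_eq_true, true_and]
  tauto

end CubicForm

namespace CubicForm

variable {k V : Type*} [Field k] [AddCommGroup V] [Module k V]
  {Φ : V →ₗ[k] V →ₗ[k] V →ₗ[k] k} {L M N K W : Submodule k V} {τ T : V →ₗ[k] V} {a b x y z : V}

/-- `L`, `M` and `N` are pairwise skew lines on the surface, and `N` is the graph of the
restriction of `τ` to a map from `L` to `M`. -/
structure IsSkewGraph (Φ : V →ₗ[k] V →ₗ[k] V →ₗ[k] k) (L M N : Submodule k V) (τ : V →ₗ[k] V) :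
    Prop where
  line₁ : IsLine Φ L
  line₂ : IsLine Φ M
  line₃ : IsLine Φ N
  inf₁₂ : L ⊓ M = ⊥
  inf₁₃ : L ⊓ N = ⊥
  inf₂₃ : M ⊓ N = ⊥
  map_mem : ∀ x, τ x ∈ M
  add_map_mem : ∀ x, x + τ x ∈ N

lemma sup_eq_top_of_inf_eq_bot [FiniteDimensional k V] (hV : finrank k V = 4) (hL : finrank k L = 2)
    (hM : finrank k M = 2) (h : L ⊓ M = ⊥) : L ⊔ M = ⊤ :=
  eq_top_of_disjoint _ _ (by omega) (disjoint_iff.2 h)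

lemma exists_isSkewGraph [FiniteDimensional k V] (hV : finrank k V = 4) (hL : IsLine Φ L)
    (hM : IsLine Φ M) (hN : IsLine Φ N) (h₁₂ : L ⊓ M = ⊥) (h₁₃ : L ⊓ N = ⊥) (h₂₃ : M ⊓ N = ⊥) :
    ∃ τ, IsSkewGraph Φ L M N τ := by
  have hc : IsCompl M N := ⟨disjoint_iff.2 h₂₃,
    codisjoint_iff.2 (sup_eq_top_of_inf_eq_bot hV hM.1 hN.1 h₂₃)⟩
  refine ⟨-M.projection N hc, hL, hM, hN, h₁₂, h₁₃, h₂₃, fun x => ?_, fun x => ?_⟩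
  · exact neg_mem (projection_apply_mem hc x)
  · rw [LinearMap.neg_apply, ← sub_eq_add_neg]
    exact sub_projection_mem hc x

lemma IsSmooth.apply_add (hΦ : IsSmooth Φ) {x y z x' y' z' : V} (h : Φ x y z = 0)
    (h' : Φ x' y' z' = 0) : Φ (x + x') (y + y') (z + z') = Φ x y z' + Φ x z y' + Φ y z x' +
      Φ x y' z' + Φ y x' z' + Φ z x' y' := by
  simp only [map_add, LinearMap.add_apply, h, h']
  rw [hΦ.swap₂₃ x z y', hΦ.swap₁₂ y x' z', hΦ.swap₁₃ z x' y', hΦ.swap₁₂ y' x' z, hΦ.swap₁₂ x' y z,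
    hΦ.swap₂₃ y z x']
  ring

namespace IsSkewGraph

lemma eq_zero_of_mem (h : IsSkewGraph Φ L M N τ) (hx : x ∈ L) (hx' : x ∈ M) : x = 0 :=
  (mem_bot k).1 (h.inf₁₂ ▸ mem_inf.2 ⟨hx, hx'⟩)

lemma eq_map (h : IsSkewGraph Φ L M N τ) (hy : y ∈ M) (hxy : x + y ∈ N) : y = τ x := by
  have : y - τ x ∈ M ⊓ N :=
    ⟨sub_mem hy (h.map_mem x), by simpa using sub_mem hxy (h.add_map_mem x)⟩
  rw [h.inf₂₃] at this
  exact sub_eq_zero.1 ((mem_bot k).1 this)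

lemma eq_zero_of_map (h : IsSkewGraph Φ L M N τ) (hx : x ∈ L) (h0 : τ x = 0) : x = 0 := by
  have : x ∈ L ⊓ N := ⟨hx, by simpa [h0] using h.add_map_mem x⟩
  rwa [h.inf₁₃, mem_bot] at this

lemma exists_map_eq [FiniteDimensional k V] (h : IsSkewGraph Φ L M N τ) (hV : finrank k V = 4)
    (hy : y ∈ M) : ∃ x ∈ L, τ x = y := by
  have : y ∈ L ⊔ N := sup_eq_top_of_inf_eq_bot hV h.line₁.1 h.line₃.1 h.inf₁₃ ▸ mem_top
  obtain ⟨l, hl, n, hn, rfl⟩ := mem_sup.1 this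
  exact ⟨-l, neg_mem hl, (h.eq_map hy (by simpa using hn)).symm⟩

lemma linearIndependent (h : IsSkewGraph Φ L M N τ) (hx : x ∈ L) (h0 : x ≠ 0) :
    LinearIndependent k ![x, τ x] := by
  rw [LinearIndependent.pair_iff' h0]
  intro c hc
  have := h.eq_zero_of_mem (hc ▸ smul_mem _ c hx) (h.map_mem x)
  exact h0 (h.eq_zero_of_map hx this)

lemma linearIndependent_map (h : IsSkewGraph Φ L M N τ) (ha : a ∈ L) (hb : b ∈ L)
    (hab : LinearIndependent k ![a, b]) : LinearIndependent k ![τ a, τ b] := by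
  rw [LinearIndependent.pair_iff] at hab ⊢
  intro s t hst
  exact hab s t (h.eq_zero_of_map (add_mem (smul_mem _ _ ha) (smul_mem _ _ hb)) (by simpa using hst))

/-- The polarised form of the vanishing of the cubic form on the graph. -/
lemma apply_eq_zero (h : IsSkewGraph Φ L M N τ) (hΦ : IsSmooth Φ) (hx : x ∈ L) (hy : y ∈ L)
    (hz : z ∈ L) : Φ x y (τ z) + Φ x z (τ y) + Φ y z (τ x) +
      Φ x (τ y) (τ z) + Φ y (τ x) (τ z) + Φ z (τ x) (τ y) = 0 := by
  rw [← hΦ.apply_add (h.line₁.2 x hx y hy z hz)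
    (h.line₂.2 _ (h.map_mem x) _ (h.map_mem y) _ (h.map_mem z))]
  exact h.line₃.2 _ (h.add_map_mem x) _ (h.add_map_mem y) _ (h.add_map_mem z)

lemma apply_map_map [CharZero k] (h : IsSkewGraph Φ L M N τ) (hΦ : IsSmooth Φ) (hx : x ∈ L) :
    Φ x (τ x) (τ x) = - Φ x x (τ x) := by
  have h3 : (3 : k) ≠ 0 := by norm_num
  refine mul_left_cancel₀ h3 ?_
  linear_combination h.apply_eq_zero hΦ hx hx hx

/-- The binary cubic form `Φ x x (τ x)` on `L` has no double root. -/
lemma deriv_ne_zero [CharZero k] [FiniteDimensional k V] (h : IsSkewGraph Φ L M N τ)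
    (hΦ : IsSmooth Φ) (hV : finrank k V = 4) (ha : a ∈ L) (hb : b ∈ L)
    (hab : LinearIndependent k ![a, b]) (h0 : Φ a a (τ a) = 0) :
    Φ a a (τ b) + 2 * Φ a b (τ a) ≠ 0 := by
  intro hd
  have ha0 : a ≠ 0 := hab.ne_zero 0
  have hL := eq_span_pair_of_finrank_eq_two h.line₁.1 ha hb hab
  have hM := eq_span_pair_of_finrank_eq_two h.line₂.1 (h.map_mem a) (h.map_mem b)
    (h.linearIndependent_map ha hb hab)
  have key : ∀ u, Φ u u a = 0 → Φ u u b = 0 → Φ u u (τ a) = 0 → Φ u u (τ b) = 0 → u = 0 := by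
    intro u h1 h2 h3 h4
    by_contra hu
    obtain ⟨v, hv⟩ := hΦ.point u hu
    have : v ∈ L ⊔ M := sup_eq_top_of_inf_eq_bot hV h.line₁.1 h.line₂.1 h.inf₁₂ ▸ mem_top
    obtain ⟨l, hl, m, hm, rfl⟩ := mem_sup.1 this
    rw [hL] at hl
    rw [hM] at hm
    obtain ⟨_, _, rfl⟩ := mem_span_pair.1 hl
    obtain ⟨_, _, rfl⟩ := mem_span_pair.1 hm
    simp [h1, h2, h3, h4] at hv
  have hN := h.apply_eq_zero hΦ ha ha hb
  rw [hΦ.swap₁₂ b (τ a) (τ a), hΦ.swap₂₃ (τ a) b (τ a)] at hN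
  have aaa := h.line₁.2 a ha a ha a ha
  have aab := h.line₁.2 a ha a ha b hb
  have ppp := h.line₂.2 _ (h.map_mem a) _ (h.map_mem a) _ (h.map_mem a)
  have ppq := h.line₂.2 _ (h.map_mem a) _ (h.map_mem a) _ (h.map_mem b)
  have h0' := h.apply_map_map hΦ ha
  rw [h0, neg_zero] at h0'
  have apa : Φ a (τ a) a = 0 := by rw [hΦ.swap₂₃, h0]
  have paa : Φ (τ a) a a = 0 := by rw [hΦ.swap₁₂, apa]
  have pap : Φ (τ a) a (τ a) = 0 := by rw [hΦ.swap₁₂, h0']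
  have ppa : Φ (τ a) (τ a) a = 0 := by rw [hΦ.swap₂₃, pap]
  have pab : Φ (τ a) a b = Φ a b (τ a) := by rw [hΦ.swap₁₂, hΦ.swap₂₃]
  have apb : Φ a (τ a) b = Φ a b (τ a) := by rw [hΦ.swap₂₃]
  have paq := hΦ.swap₁₂ (τ a) a (τ b)
  have hu := key (Φ a (τ a) (τ b) • a + Φ a b (τ a) • τ a)
  simp only [map_add, map_smul, LinearMap.add_apply, LinearMap.smul_apply, smul_eq_mul, aaa, aab,
    ppp, ppq, h0, h0', apa, paa, pap, ppa, pab, apb, paq] at hu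
  have hu' := hu (by ring) (by
    have : Φ (τ a) (τ a) b = - 2 * Φ a (τ a) (τ b) := by
      linear_combination hN - hd
    rw [this]; ring) (by ring) (by
    linear_combination Φ a (τ a) (τ b) ^ 2 * hd)
  have hA := LinearIndependent.pair_iff.1 (h.linearIndependent ha ha0) _ _ hu'
  refine ha0 (key a aaa aab h0 ?_)
  linear_combination hd - 2 * hA.2

end IsSkewGraph

end CubicForm

namespace CubicForm

variable {k V : Type*} [Field k] [AddCommGroup V] [Module k V]
  {Φ : V →ₗ[k] V →ₗ[k] V →ₗ[k] k} {L M N K W : Submodule k V} {τ T : V →ₗ[k] V} {a b x y z : V}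

lemma IsSmooth.apply_combination (hΦ : IsSmooth Φ) (τ : V →ₗ[k] V) (x y : V) (s t : k) :
    Φ (s • x + t • y) (s • x + t • y) (τ (s • x + t • y)) =
      s ^ 3 * Φ x x (τ x) + s ^ 2 * t * (Φ x x (τ y) + 2 * Φ x y (τ x)) +
      s * t ^ 2 * (Φ y y (τ x) + 2 * Φ x y (τ y)) + t ^ 3 * Φ y y (τ y) := by
  simp only [map_add, map_smul, LinearMap.add_apply, LinearMap.smul_apply, smul_eq_mul]
  rw [hΦ.swap₁₂ y x, hΦ.swap₁₂ y x]
  ring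

namespace IsSkewGraph

lemma isLine_span [CharZero k] (h : IsSkewGraph Φ L M N τ) (hΦ : IsSmooth Φ) (hx : x ∈ L)
    (hx0 : x ≠ 0) (hg : Φ x x (τ x) = 0) : IsLine Φ (span k {x, τ x}) :=
  hΦ.isLine_span_pair (h.linearIndependent hx hx0) (h.line₁.2 x hx x hx x hx) hg
    (by rw [h.apply_map_map hΦ hx, hg, neg_zero])
    (h.line₂.2 _ (h.map_mem x) _ (h.map_mem x) _ (h.map_mem x))

lemma exists_smul_eq (h : IsSkewGraph Φ L M N τ) (hx : x ∈ L) (hy : y ∈ L)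
    (hyx : y ∈ span k {x, τ x}) : ∃ c : k, c • x = y := by
  obtain ⟨c, d, rfl⟩ := mem_span_pair.1 hyx
  have hd := h.eq_zero_of_mem (by simpa using sub_mem hy (smul_mem _ c hx))
    (smul_mem _ d (h.map_mem x))
  exact ⟨c, by rw [hd, add_zero]⟩

lemma span_smul_eq {c : k} (hc : c ≠ 0) : span k {c • x, τ (c • x)} = span k {x, τ x} := by
  apply le_antisymm <;> rw [span_le] <;> rintro _ (rfl | rfl) <;> rw [SetLike.mem_coe, mem_span_pair]
  · exact ⟨c, 0, by simp⟩
  · exact ⟨0, c, by simp⟩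
  · exact ⟨c⁻¹, 0, by simp [hc]⟩
  · exact ⟨0, c⁻¹, by simp [hc]⟩

lemma exists_eq_span (h : IsSkewGraph Φ L M N τ) (hW : IsLine Φ W) (hL : W ⊓ L ≠ ⊥) (hM : W ⊓ M ≠ ⊥) (hN : W ⊓ N ≠ ⊥) :
    ∃ x ∈ L, x ≠ 0 ∧ Φ x x (τ x) = 0 ∧ W = span k {x, τ x} := by
  obtain ⟨x, hx, hx0⟩ := (Submodule.ne_bot_iff _).1 hL
  obtain ⟨y, hy, hy0⟩ := (Submodule.ne_bot_iff _).1 hM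
  obtain ⟨z, hz, hz0⟩ := (Submodule.ne_bot_iff _).1 hN
  have hxy : LinearIndependent k ![x, y] := by
    rw [LinearIndependent.pair_iff' hx0]
    rintro c rfl
    exact hy0 (h.eq_zero_of_mem (smul_mem _ _ hx.2) hy.2)
  have hWe := eq_span_pair_of_finrank_eq_two hW.1 hx.1 hy.1 hxy
  obtain ⟨c, d, rfl⟩ := mem_span_pair.1 (hWe ▸ hz.1)
  have hyτ := h.eq_map (smul_mem _ d hy.2) hz.2
  have hc0 : c • x ≠ 0 := by
    intro h0
    rw [h0, map_zero] at hyτ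
    exact hz0 (by rw [h0, hyτ, add_zero])
  have hxW : c • x ∈ W := smul_mem _ _ hx.1
  have hτW : τ (c • x) ∈ W := hyτ ▸ smul_mem _ _ hy.1
  exact ⟨c • x, smul_mem _ _ hx.2, hc0, hW.2 _ hxW _ hxW _ hτW,
    eq_span_pair_of_finrank_eq_two hW.1 hxW hτW (h.linearIndependent (smul_mem _ _ hx.2) hc0)⟩

lemma span_inf_ne_bot_left (h0 : x ≠ 0) (hx : x ∈ L) : span k {x, τ x} ⊓ L ≠ ⊥ :=
  (Submodule.ne_bot_iff _).2 ⟨x, ⟨subset_span (by simp), hx⟩, h0⟩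

lemma span_inf_ne_bot_right (h : IsSkewGraph Φ L M N τ) (h0 : x ≠ 0) (hx : x ∈ L) :
    span k {x, τ x} ⊓ M ≠ ⊥ :=
  (Submodule.ne_bot_iff _).2 ⟨τ x, ⟨subset_span (by simp), h.map_mem x⟩,
    fun h' => h0 (h.eq_zero_of_map hx h')⟩

/-- A transversal meets another line skew to `L` and `M` exactly in the eigendirections of the
corresponding pencil of maps. -/
lemma span_inf_ne_bot_iff (h : IsSkewGraph Φ L M N τ) (h' : IsSkewGraph Φ L M K T) (h0 : x ≠ 0)
    (hx : x ∈ L) : span k {x, τ x} ⊓ K ≠ ⊥ ↔ ∃ c : k, T x = c • τ x := by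
  rw [Submodule.ne_bot_iff]
  constructor
  · rintro ⟨z, ⟨hz, hzK⟩, hz0⟩
    obtain ⟨c, d, rfl⟩ := mem_span_pair.1 hz
    have hT := h'.eq_map (smul_mem _ d (h.map_mem x)) hzK
    rw [map_smul] at hT
    have hc : c ≠ 0 := by
      rintro rfl
      rw [zero_smul] at hT
      exact hz0 (by rw [hT, zero_smul, add_zero])
    exact ⟨c⁻¹ * d, by rw [mul_smul, hT, smul_smul, inv_mul_cancel₀ hc, one_smul]⟩
  · rintro ⟨c, hc⟩
    refine ⟨x + T x, ⟨mem_span_pair.2 ⟨1, c, by rw [hc, one_smul]⟩, h'.add_map_mem x⟩, fun h1 => ?_⟩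
    have := h'.eq_zero_of_mem (x := T x)
      (by rw [← neg_eq_of_add_eq_zero_right h1]; exact neg_mem hx) (h'.map_mem x)
    rw [this, add_zero] at h1
    exact h0 h1

variable {A B C D m m' : {W : Submodule k V // IsLine Φ W}}

lemma mem_transversals_iff (h : IsSkewGraph Φ A.1 B.1 C.1 τ) : m ∈ (lineGraph Φ).transversals A B C ↔
      ∃ x ∈ A.1, x ≠ 0 ∧ Φ x x (τ x) = 0 ∧ m.1 = span k {x, τ x} := by
  constructor
  · rintro ⟨h₁, h₂, h₃⟩
    exact h.exists_eq_span m.2 h₁.2 h₂.2 h₃.2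
  · rintro ⟨x, hx, hx0, -, hm⟩
    have hA : m.1 ⊓ A.1 ≠ ⊥ := hm ▸ span_inf_ne_bot_left hx0 hx
    have hB : m.1 ⊓ B.1 ≠ ⊥ := hm ▸ h.span_inf_ne_bot_right hx0 hx
    have hC : m.1 ⊓ C.1 ≠ ⊥ := hm ▸ (h.span_inf_ne_bot_iff h hx0 hx).2 ⟨1, by simp⟩
    refine ⟨⟨?_, hA⟩, ⟨?_, hB⟩, ?_, hC⟩
    · rintro rfl
      exact hB h.inf₁₂
    · rintro rfl
      exact hC h.inf₂₃
    · rintro rfl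
      exact hA (by rw [inf_comm, h.inf₁₃])

/-- If two transversals of a skew triple are rational, then so is the third. -/
lemma exists_transversals_eq [CharZero k] [FiniteDimensional k V]
    (h : IsSkewGraph Φ A.1 B.1 C.1 τ) (hΦ : IsSmooth Φ) (hV : finrank k V = 4)
    (hm : m ∈ (lineGraph Φ).transversals A B C) (hm' : m' ∈ (lineGraph Φ).transversals A B C)
    (hne : m ≠ m') :
    ∃ m'', m ≠ m'' ∧ m' ≠ m'' ∧ (lineGraph Φ).transversals A B C = {m, m', m''} := by
  obtain ⟨x, hx, hx0, hgx, hmx⟩ := h.mem_transversals_iff.1 hm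
  obtain ⟨y, hy, hy0, hgy, hmy⟩ := h.mem_transversals_iff.1 hm'
  have hxy : LinearIndependent k ![x, y] := by
    rw [LinearIndependent.pair_iff' hx0]
    rintro c rfl
    refine hne (Subtype.ext ?_)
    rw [hmx, hmy, span_smul_eq]
    rintro rfl
    simp at hy0
  have hxy' := LinearIndependent.pair_iff.1 hxy
  have hd := h.deriv_ne_zero hΦ hV hx hy hxy hgx
  have hd' := h.deriv_ne_zero hΦ hV hy hx (LinearIndependent.pair_symm_iff.1 hxy) hgy
  rw [hΦ.swap₁₂ y x] at hd'
  have hg := hΦ.apply_combination τ x y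
  set c := Φ x x (τ y) + 2 * Φ x y (τ x)
  set d := Φ y y (τ x) + 2 * Φ x y (τ y)
  have hz : d • x + (-c) • y ∈ A.1 := add_mem (smul_mem _ _ hx) (smul_mem _ _ hy)
  have hz0 : d • x + (-c) • y ≠ 0 := fun h0 => hd' (hxy' _ _ h0).1
  have hgz := hg d (-c)
  rw [hgx, hgy] at hgz
  have hgz0 : Φ (d • x + (-c) • y) (d • x + (-c) • y) (τ (d • x + (-c) • y)) = 0 := by
    rw [hgz]; ring
  have hm'' := (h.mem_transversals_iff (m := ⟨_, h.isLine_span hΦ hz hz0 hgz0⟩)).2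
    ⟨_, hz, hz0, hgz0, rfl⟩
  refine ⟨⟨_, h.isLine_span hΦ hz hz0 hgz0⟩, ?_, ?_, Set.Subset.antisymm ?_ ?_⟩
  · intro e
    have e := congrArg Subtype.val e
    rw [hmx] at e
    have e' : d • x + (-c) • y ∈ span k {x, τ x} := e ▸ subset_span (by simp)
    obtain ⟨r, hr⟩ := h.exists_smul_eq hx hz e'
    have := hxy' (d - r) (-c) (by rw [sub_smul, hr]; abel)
    exact hd (neg_eq_zero.1 this.2)
  · intro e
    have e := congrArg Subtype.val e
    rw [hmy] at e
    have e' : d • x + (-c) • y ∈ span k {y, τ y} := e ▸ subset_span (by simp)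
    obtain ⟨r, hr⟩ := h.exists_smul_eq hy hz e'
    have := hxy' d (-c - r) (by rw [sub_smul, hr]; abel)
    exact hd' this.1
  · intro n hn
    obtain ⟨w, hw, hw0, hgw, hnw⟩ := h.mem_transversals_iff.1 hn
    rw [eq_span_pair_of_finrank_eq_two h.line₁.1 hx hy hxy] at hw
    obtain ⟨s, t, rfl⟩ := mem_span_pair.1 hw
    rw [hg, hgx, hgy] at hgw
    have hst : s * t * (s * c + t * d) = 0 := by linear_combination hgw
    simp only [mul_eq_zero] at hst
    simp only [Set.mem_insert_iff, Set.mem_singleton_iff, Subtype.ext_iff]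
    rcases hst with (rfl | rfl) | hst
    · right; left
      have ht : t ≠ 0 := by rintro rfl; simp at hw0
      rw [hnw, hmy, zero_smul, zero_add, span_smul_eq ht]
    · left
      have hs : s ≠ 0 := by rintro rfl; simp at hw0
      rw [hnw, hmx, zero_smul, add_zero, span_smul_eq hs]
    · right; right
      have hs : s ≠ 0 := by
        rintro rfl
        have : t = 0 := by simpa [hd'] using hst
        simp [this] at hw0
      rw [hnw, ← span_smul_eq (x := d • x + (-c) • y) (div_ne_zero hs hd')]
      have : s • x + t • y = (s / d) • (d • x + (-c) • y) := by
        rw [smul_add, smul_smul, smul_smul, div_mul_cancel₀ _ hd']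
        congr 2
        field_simp
        linear_combination hst
      rw [this]
  · rintro n (rfl | rfl | rfl)
    exacts [hm, hm', hm'']

end IsSkewGraph

end CubicForm

namespace CubicForm

variable {k V : Type*} [Field k] [AddCommGroup V] [Module k V]
  {Φ : V →ₗ[k] V →ₗ[k] V →ₗ[k] k} {L M N K W : Submodule k V} {τ T : V →ₗ[k] V} {a b x y z : V}

namespace IsSkewGraph

lemma eq_zero_of_map_eq (h : IsSkewGraph Φ L M N τ) (h' : IsSkewGraph Φ L M K T)
    (hNK : N ⊓ K = ⊥) (hx : x ∈ L) (he : T x = τ x) : x = 0 := by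
  have : x + τ x ∈ N ⊓ K := ⟨h.add_map_mem x, he ▸ h'.add_map_mem x⟩
  rw [hNK, mem_bot] at this
  exact h.eq_zero_of_mem hx (by
    rw [eq_neg_of_add_eq_zero_left this]
    exact neg_mem (h.map_mem x))

/-- Over an eigendirection of the pencil spanned by `τ` and `T` there is a transversal. -/
lemma apply_eq_zero_of_map_eq_smul [CharZero k] (h : IsSkewGraph Φ L M N τ) (h' : IsSkewGraph Φ L M K T)
    (hΦ : IsSmooth Φ) (hNK : N ⊓ K = ⊥) (hx : x ∈ L) {c : k} (hc : T x = c • τ x) :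
    Φ x x (τ x) = 0 := by
  have h1 := h.apply_map_map hΦ hx
  have h2 := h'.apply_map_map hΦ hx
  simp only [hc, map_smul, LinearMap.smul_apply, smul_eq_mul] at h2
  have h3 : c * (c - 1) * Φ x x (τ x) = 0 := by linear_combination c ^ 2 * h1 - h2
  simp only [mul_eq_zero, sub_eq_zero] at h3
  rcases h3 with (rfl | rfl) | h3
  · rw [h'.eq_zero_of_map hx (by rw [hc, zero_smul])]
    simp
  · rw [h.eq_zero_of_map_eq h' hNK hx (by rw [hc, one_smul])]
    simp
  · exact h3

lemma exists_not_eigenvector [CharZero k] [FiniteDimensional k V] (h : IsSkewGraph Φ L M N τ)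
    (h' : IsSkewGraph Φ L M K T) (hΦ : IsSmooth Φ) (hV : finrank k V = 4) (hNK : N ⊓ K = ⊥) :
    ∃ a ∈ L, ∀ c : k, T a ≠ c • τ a := by
  by_contra! H
  have hg : ∀ x ∈ L, Φ x x (τ x) = 0 := fun x hx => by
    obtain ⟨c, hc⟩ := H x hx
    exact h.apply_eq_zero_of_map_eq_smul h' hΦ hNK hx hc
  obtain ⟨x, hx, hx0⟩ := exists_mem_ne_zero_of_finrank_eq_two h.line₁.1
  obtain ⟨y, hy, hxy⟩ := exists_linearIndependent_pair h.line₁.1 hx0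
  refine h.deriv_ne_zero hΦ hV hx hy hxy (hg x hx) ?_
  have h1 := hΦ.apply_combination τ x y 1 1
  have h2 := hΦ.apply_combination τ x y 1 (-1)
  rw [hg x hx, hg y hy, hg _ (add_mem (smul_mem _ _ hx) (smul_mem _ _ hy))] at h1 h2
  linear_combination (h2 - h1) / 2

/-- In a basis where the pencil spanned by `τ` and `T` is in companion form, its characteristic
polynomial divides the binary cubic form whose roots are the transversals. -/
lemma apply_combination_eq_mul [CharZero k] (h : IsSkewGraph Φ L M N τ) (h' : IsSkewGraph Φ L M K T)
    (hΦ : IsSmooth Φ) (ha : a ∈ L) (hb : b ∈ L) {c d : k} (hTa : T a = τ b)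
    (hTb : T b = c • τ a + d • τ b) (hc : c ≠ 0) (hcd : 1 - d - c ≠ 0) (s t : k) :
    Φ (s • a + t • b) (s • a + t • b) (τ (s • a + t • b)) =
      (s ^ 2 + d * (s * t) - c * t ^ 2) *
        (s * Φ a a (τ a) + t * (Φ a a (τ b) + 2 * Φ a b (τ a) - d * Φ a a (τ a))) := by
  have hP := h.apply_eq_zero hΦ ha ha ha
  have hP' := h.apply_eq_zero hΦ ha ha hb
  have hQ' := h.apply_eq_zero hΦ ha hb hb
  have hR' := h.apply_eq_zero hΦ hb hb hb
  have h1 := h'.apply_eq_zero hΦ ha ha ha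
  have h2 := h'.apply_eq_zero hΦ ha ha hb
  have h3 := h'.apply_eq_zero hΦ ha hb hb
  have h4 := h'.apply_eq_zero hΦ hb hb hb
  have e2 := fun x => hΦ.swap₂₃ x (τ b) (τ a)
  simp only [hTa, hTb, map_add, map_smul, LinearMap.add_apply, LinearMap.smul_apply, smul_eq_mul,
    e2] at hP hP' hQ' hR' h1 h2 h3 h4
  rw [hΦ.apply_combination τ a b]
  set aap := Φ a a (τ a)
  set aaq := Φ a a (τ b)
  set abp := Φ a b (τ a)
  set abq := Φ a b (τ b)
  set bbp := Φ b b (τ a)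
  set bbq := Φ b b (τ b)
  set app := Φ a (τ a) (τ a)
  set apq := Φ a (τ a) (τ b)
  set aqq := Φ a (τ b) (τ b)
  set bpp := Φ b (τ a) (τ a)
  set bpq := Φ b (τ a) (τ b)
  set bqq := Φ b (τ b) (τ b)
  have hP : app = -aap := by linear_combination hP / 3
  have hP' : bpp = -aaq - 2 * abp - 2 * apq := by linear_combination hP'
  have hR : aqq = -aaq := by linear_combination h1 / 3
  have hR' : bqq = -bbq := by linear_combination hR' / 3
  have hQ' : 2 * bpq = aaq - 2 * abq - bbp := by linear_combination hQ' - hR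
  have hQ : 2 * c * apq = bbq - c * aap + d * aaq - 2 * abq := by
    linear_combination h2 - 2 * d * hR - hR'
  have hI : c * (aaq + 2 * abp) - c * (2 * abq + bbp) + (1 - d) * bbq - c * (c + d) * aap = 0 := by
    linear_combination h3 - c ^ 2 * hP - d * hQ - d ^ 2 * hR - c * hQ' - 2 * d * hR'
  have hII : c * (1 - d) * (2 * abq + bbp) - c ^ 2 * (aaq + 2 * abp) + c ^ 2 * aap +
      (d - c - d ^ 2) * bbq = 0 := by
    linear_combination h4 / 3 - c ^ 2 * hP' + c * hQ - c * d * hQ' - d ^ 2 * hR'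
  have h₃ : bbq = - c * (aaq + 2 * abp - d * aap) := by
    refine mul_left_cancel₀ hcd ?_
    linear_combination (1 - d) * hI + hII
  have h₂ : bbp + 2 * abq = - c * aap + d * (aaq + 2 * abp - d * aap) := by
    refine mul_left_cancel₀ hc ?_
    linear_combination (1 - d) * h₃ - hI
  rw [h₃, h₂]
  ring

/-- The binary cubic form of the transversals, in terms of a fourth line `K` skew to `L, M, N`. -/
lemma exists_eigenvector [CharZero k] [FiniteDimensional k V] (h : IsSkewGraph Φ L M N τ)
    (h' : IsSkewGraph Φ L M K T) (hΦ : IsSmooth Φ) (hV : finrank k V = 4) (hNK : N ⊓ K = ⊥) :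
    (∃ x ∈ L, x ≠ 0 ∧ Φ x x (τ x) = 0 ∧ (∀ c : k, T x ≠ c • τ x) ∧
      ∀ y ∈ L, Φ y y (τ y) = 0 → ∃ c : k, c • x = y) ∨
    ∃ x ∈ L, ∃ y ∈ L, LinearIndependent k ![x, y] ∧ (∃ c : k, T x = c • τ x) ∧
      ∃ c : k, T y = c • τ y := by
  obtain ⟨a, ha, hTa⟩ := h.exists_not_eigenvector h' hΦ hV hNK
  have ha0 : a ≠ 0 := by
    rintro rfl
    exact hTa 0 (by simp)
  obtain ⟨b, hb, hτb⟩ := h.exists_map_eq hV (h'.map_mem a)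
  have hab : LinearIndependent k ![a, b] := by
    rw [LinearIndependent.pair_iff' ha0]
    rintro r rfl
    exact hTa r (by rw [← hτb, map_smul])
  have hab' := LinearIndependent.pair_iff.1 hab
  have hL := eq_span_pair_of_finrank_eq_two h.line₁.1 ha hb hab
  have hτab := h.linearIndependent_map ha hb hab
  have hTb := h'.map_mem b
  rw [eq_span_pair_of_finrank_eq_two h.line₂.1 (h.map_mem a) (h.map_mem b) hτab,
    mem_span_pair] at hTb
  obtain ⟨c, d, hTb⟩ := hTb
  have hc : c ≠ 0 := by
    rintro rfl
    have := h'.eq_zero_of_map (x := b - d • a) (sub_mem hb (smul_mem _ _ ha))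
      (by rw [map_sub, map_smul, ← hTb, hτb]; module)
    exact one_ne_zero (hab' (-d) 1 (by rw [← this]; module)).2
  have hcd : 1 - d - c ≠ 0 := by
    intro h0
    have := h.eq_zero_of_map_eq h' hNK (x := c • a + (1 : k) • b)
      (add_mem (smul_mem _ _ ha) (smul_mem _ _ hb)) (by
        simp only [map_add, map_smul, ← hTb, ← hτb]
        have : c = 1 - d := by linear_combination -h0
        rw [this]
        module)
    exact one_ne_zero (hab' _ _ this).2
  have hg := h.apply_combination_eq_mul h' hΦ ha hb hτb.symm hTb.symm hc hcd
  have hgd := h.deriv_ne_zero hΦ hV ha hb hab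
  set m₀ := Φ a a (τ a)
  set m₁ := Φ a a (τ b) + 2 * Φ a b (τ a) - d * m₀ with hm₁
  have heig : ∀ s t : k, (∃ r : k, T (s • a + t • b) = r • τ (s • a + t • b)) ↔
      s ^ 2 + d * (s * t) - c * t ^ 2 = 0 := by
    intro s t
    have hT : T (s • a + t • b) = (t * c) • τ a + (s + t * d) • τ b := by
      rw [map_add, map_smul, map_smul, ← hTb, ← hτb]
      module
    rw [hT]
    constructor
    · rintro ⟨r, hr⟩
      have := LinearIndependent.pair_iff.1 hτab (t * c - r * s) (s + t * d - r * t) (by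
        rw [← sub_eq_zero] at hr
        rw [← hr, map_add, map_smul, map_smul]
        module)
      linear_combination s * this.2 - t * this.1
    · intro h0
      by_cases hs : s = 0
      · subst hs
        have ht : t = 0 := by simpa [hc] using h0
        exact ⟨0, by simp [ht]⟩
      · refine ⟨t * c / s, ?_⟩
        have : s + t * d = t * c / s * t := by
          field_simp
          linear_combination h0
        rw [this, map_add, map_smul, map_smul, smul_add, smul_smul, smul_smul,
          div_mul_cancel₀ _ hs]
  have hm : ¬ (m₀ = 0 ∧ m₁ = 0) := by
    rintro ⟨h0, h1⟩
    exact hgd h0 (by linear_combination h1 - hm₁ + d * h0)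
  by_cases hq : ∃ s t : k, (s ≠ 0 ∨ t ≠ 0) ∧ s ^ 2 + d * (s * t) - c * t ^ 2 = 0
  · right
    obtain ⟨s, t, hst, hq⟩ := hq
    have ht : t ≠ 0 := by
      rintro rfl
      have : s = 0 := by simpa using hq
      simp [this] at hst
    have hx : s • a + t • b ∈ L := add_mem (smul_mem _ _ ha) (smul_mem _ _ hb)
    have hdisc : 2 * s + d * t ≠ 0 := by
      intro h0
      have hxa : LinearIndependent k ![s • a + t • b, a] := by
        rw [LinearIndependent.pair_iff]
        intro r r' hr
        have := hab' (r * s + r') (r * t) (by rw [← hr]; module)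
        have hr0 := (mul_eq_zero.1 this.2).resolve_right ht
        exact ⟨hr0, by simpa [hr0] using this.1⟩
      have hgx : Φ (s • a + t • b) (s • a + t • b) (τ (s • a + t • b)) = 0 := by
        rw [hg, hq, zero_mul]
      refine h.deriv_ne_zero hΦ hV hx ha hxa hgx ?_
      have h1 := hΦ.apply_combination τ (s • a + t • b) a 1 1
      have h2 := hΦ.apply_combination τ (s • a + t • b) a 1 (-1)
      have e1 : (1 : k) • (s • a + t • b) + (1 : k) • a = (s + 1) • a + t • b := by module
      have e2 : (1 : k) • (s • a + t • b) + (-1 : k) • a = (s - 1) • a + t • b := by module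
      rw [e1, hg, hgx] at h1
      rw [e2, hg, hgx] at h2
      linear_combination (h2 - h1) / 2 + (s * m₀ + t * m₁) * h0 + m₀ * hq
    refine ⟨_, hx, (-d * t - s) • a + t • b, add_mem (smul_mem _ _ ha) (smul_mem _ _ hb), ?_,
      (heig _ _).2 hq, (heig _ _).2 (by linear_combination hq)⟩
    rw [LinearIndependent.pair_iff]
    intro r r' hr
    have := hab' (r * s + r' * (-d * t - s)) (t * (r + r')) (by rw [← hr]; module)
    have hrr := (mul_eq_zero.1 this.2).resolve_left ht
    have hr0 : r = 0 := by
      refine (mul_eq_zero.1 (?_ : r * (2 * s + d * t) = 0)).resolve_right hdisc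
      linear_combination this.1 + (d * t + s) * hrr
    exact ⟨hr0, by simpa [hr0] using hrr⟩
  · left
    push Not at hq
    refine ⟨m₁ • a + (-m₀) • b, add_mem (smul_mem _ _ ha) (smul_mem _ _ hb), ?_, ?_, ?_, ?_⟩
    · intro h0
      have := hab' _ _ h0
      exact hm ⟨neg_eq_zero.1 this.2, this.1⟩
    · rw [hg]
      ring
    · rw [← not_exists, heig]
      exact hq _ _ (by rw [neg_ne_zero]; tauto)
    · intro y hy hgy
      rw [hL] at hy
      obtain ⟨s, t, rfl⟩ := mem_span_pair.1 hy
      rw [hg, mul_eq_zero] at hgy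
      by_cases hst : s ≠ 0 ∨ t ≠ 0
      · have := hgy.resolve_left (hq s t hst)
        by_cases h1 : m₁ = 0
        · have h0 : m₀ ≠ 0 := fun h0 => hm ⟨h0, h1⟩
          have hs : s = 0 := by simpa [h1, h0] using this
          refine ⟨-(t / m₀), ?_⟩
          rw [h1, hs, zero_smul, zero_add, zero_add, smul_smul, neg_mul_neg,
            div_mul_cancel₀ _ h0]
        · refine ⟨s / m₁, ?_⟩
          have ht : t = s / m₁ * -m₀ := by
            field_simp
            linear_combination this
          rw [ht, smul_add, smul_smul, smul_smul, div_mul_cancel₀ _ h1]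
      · push Not at hst
        exact ⟨0, by simp [hst]⟩

end IsSkewGraph

end CubicForm

namespace CubicForm

variable {k V : Type*} [Field k] [AddCommGroup V] [Module k V]
  {Φ : V →ₗ[k] V →ₗ[k] V →ₗ[k] k} {A B C D : {W : Submodule k V // IsLine Φ W}}

lemma inf_eq_bot_of_not_adj (hne : A ≠ B) (h : ¬ (lineGraph Φ).Adj A B) : A.1 ⊓ B.1 = ⊥ := by
  by_contra h'
  exact h ⟨hne, h'⟩

variable [FiniteDimensional k V]

lemma exists_isSkewGraph_of_skewTriple (hV : finrank k V = 4)
    (h : (lineGraph Φ).SkewTriple A B C) : ∃ τ, IsSkewGraph Φ A.1 B.1 C.1 τ :=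
  exists_isSkewGraph hV A.2 B.2 C.2 (inf_eq_bot_of_not_adj h.ne_ab h.nadj_ab)
    (inf_eq_bot_of_not_adj h.ne_ac h.nadj_ac) (inf_eq_bot_of_not_adj h.ne_bc h.nadj_bc)

/-- If a line `D` is skew to the lines of a skew triple, then either the triple has a unique
transversal and `D` does not meet it, or `D` meets two of the transversals. -/
lemma transversals_of_mem_adjNone [CharZero k] (hΦ : IsSmooth Φ) (hV : finrank k V = 4)
    (h : (lineGraph Φ).SkewTriple A B C) (hD : D ∈ (lineGraph Φ).adjNone A B C) :
    (∃ m, (lineGraph Φ).transversals A B C = {m} ∧ ¬ (lineGraph Φ).Adj D m) ∨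
      ∃ m ∈ (lineGraph Φ).transversals A B C, ∃ m' ∈ (lineGraph Φ).transversals A B C,
        m ≠ m' ∧ (lineGraph Φ).Adj D m ∧ (lineGraph Φ).Adj D m' := by
  obtain ⟨⟨hDA, hDB, hDC⟩, hA, hB, hC⟩ := hD
  have hA := inf_eq_bot_of_not_adj hDA hA
  have hB := inf_eq_bot_of_not_adj hDB hB
  have hC := inf_eq_bot_of_not_adj hDC hC
  rw [inf_comm] at hA hB hC
  obtain ⟨τ, hτ⟩ := exists_isSkewGraph_of_skewTriple hV h
  obtain ⟨T, hT⟩ := exists_isSkewGraph hV A.2 B.2 D.2 hτ.inf₁₂ hA hB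
  rcases hτ.exists_eigenvector hT hΦ hV hC with ⟨x, hx, hx0, hgx, hTx, H⟩ |
    ⟨x, hx, y, hy, hxy, ⟨c, hTx⟩, d, hTy⟩
  · left
    have hm := hτ.isLine_span hΦ hx hx0 hgx
    refine ⟨⟨_, hm⟩, Set.eq_singleton_iff_unique_mem.2
      ⟨hτ.mem_transversals_iff.2 ⟨x, hx, hx0, hgx, rfl⟩, fun m' hm' => ?_⟩, fun hadj => ?_⟩
    · obtain ⟨y, hy, hy0, hgy, e⟩ := hτ.mem_transversals_iff.1 hm'
      obtain ⟨c, rfl⟩ := H y hy hgy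
      refine Subtype.ext ?_
      rw [e, IsSkewGraph.span_smul_eq]
      rintro rfl
      simp at hy0
    · have := hadj.2
      rw [inf_comm] at this
      obtain ⟨c, hc⟩ := (hτ.span_inf_ne_bot_iff hT hx0 hx).1 this
      exact hTx c hc
  · right
    have hx0 : x ≠ 0 := hxy.ne_zero 0
    have hy0 : y ≠ 0 := hxy.ne_zero 1
    have hgx := hτ.apply_eq_zero_of_map_eq_smul hT hΦ hC hx hTx
    have hgy := hτ.apply_eq_zero_of_map_eq_smul hT hΦ hC hy hTy
    have hmx := hτ.mem_transversals_iff.2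
      ⟨x, hx, hx0, hgx, (rfl : (⟨_, hτ.isLine_span hΦ hx hx0 hgx⟩ :
        {W : Submodule k V // IsLine Φ W}).1 = _)⟩
    have hmy := hτ.mem_transversals_iff.2
      ⟨y, hy, hy0, hgy, (rfl : (⟨_, hτ.isLine_span hΦ hy hy0 hgy⟩ :
        {W : Submodule k V // IsLine Φ W}).1 = _)⟩
    have hadj : ∀ m ∈ (lineGraph Φ).transversals A B C, D.1 ⊓ m.1 ≠ ⊥ → (lineGraph Φ).Adj D m := by
      rintro m hm hDm
      refine ⟨?_, hDm⟩
      rintro rfl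
      exact hm.1.2 (by rw [inf_comm, hA])
    refine ⟨_, hmx, _, hmy, fun e => ?_, hadj _ hmx ?_, hadj _ hmy ?_⟩
    · have hyx : y ∈ span k {x, τ x} := by
        have e : span k {x, τ x} = span k {y, τ y} := congrArg Subtype.val e
        rw [e]
        exact subset_span (by simp)
      obtain ⟨r, hr⟩ := hτ.exists_smul_eq hx hy hyx
      exact (LinearIndependent.pair_iff' hx0).1 hxy r hr
    · rw [inf_comm]
      exact (hτ.span_inf_ne_bot_iff hT hx0 hx).2 ⟨c, hTx⟩
    · rw [inf_comm]
      exact (hτ.span_inf_ne_bot_iff hT hy0 hy).2 ⟨d, hTy⟩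

/-- A smooth cubic surface with a skew triple of rational lines has `3`, `7`, `9`, `15` or `27`
rational lines. -/
theorem IsSmooth.encard_lines_mem [CharZero k] (hΦ : IsSmooth Φ) (hV : finrank k V = 4)
    (h : (lineGraph Φ).SkewTriple A B C) :
    (Set.univ : Set {W : Submodule k V // IsLine Φ W}).encard ∈ ({3, 7, 9, 15, 27} : Set ℕ∞) := by
  refine SimpleGraph.SkewTriple.encard_univ_mem (lineGraph_isTritangent hΦ hV) h ?_
    fun _ => transversals_of_mem_adjNone hΦ hV h
  intro a b c m m' habc hm hm' hne
  obtain ⟨τ, hτ⟩ := exists_isSkewGraph_of_skewTriple hV habc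
  exact hτ.exists_transversals_eq hΦ hV hm hm' hne

end CubicForm

end Geometry

section Polarization

open LinearMap

variable {K : Type*} [Field K]

lemma MvPolynomial.pderiv_comm {σ R : Type*} [CommRing R] (i j : σ) (f : MvPolynomial σ R) :
    pderiv i (pderiv j f) = pderiv j (pderiv i f) := by
  classical
  have : ⁅pderiv (R := R) i, pderiv j⁆ = 0 := derivation_ext fun l => by
    rw [Derivation.commutator_apply, pderiv_X, pderiv_X, Pi.single_apply, Pi.single_apply]
    split_ifs <;> simp
  simpa [Derivation.commutator_apply, sub_eq_zero] using congrArg (fun D => D f) this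

lemma MvPolynomial.IsHomogeneous.sum_mul_eval_pderiv {σ R : Type*} [Fintype σ] [CommRing R]
    {f : MvPolynomial σ R} {n : ℕ} (hf : f.IsHomogeneous n) (x : σ → R) :
    ∑ i, x i * eval x (pderiv i f) = n * eval x f := by
  simpa using congrArg (eval x) hf.sum_X_mul_pderiv

lemma MvPolynomial.IsHomogeneous.eval_eq_constantCoeff {σ R : Type*} [CommRing R]
    {f : MvPolynomial σ R} (hf : f.IsHomogeneous 0) (x : σ → R) : eval x f = constantCoeff f := by
  rw [totalDegree_eq_zero_iff_eq_C.1 (Nat.le_zero.1 hf.totalDegree_le)]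
  simp

/-- The symmetric trilinear form with `polarForm f x x x = f x` when `f` is a cubic form. -/
noncomputable def polarForm (f : MvPolynomial (Fin 4) K) :
    (Fin 4 → K) →ₗ[K] (Fin 4 → K) →ₗ[K] (Fin 4 → K) →ₗ[K] K :=
  ∑ i, (proj i : (Fin 4 → K) →ₗ[K] K).smulRight (∑ j, (proj j : (Fin 4 → K) →ₗ[K] K).smulRight
    (∑ l, (constantCoeff (pderiv l (pderiv j (pderiv i f))) / 6) • (proj l : (Fin 4 → K) →ₗ[K] K)))

lemma polarForm_apply (f : MvPolynomial (Fin 4) K) (x y z : Fin 4 → K) :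
    polarForm f x y z = ∑ i, x i * ∑ j, y j * ∑ l,
      constantCoeff (pderiv l (pderiv j (pderiv i f))) / 6 * z l := by
  simp [polarForm, LinearMap.sum_apply]

lemma polarForm_eq_sum (f : MvPolynomial (Fin 4) K) (x y z : Fin 4 → K) :
    polarForm f x y z = ∑ i, x i * polarForm f (Pi.single i 1) y z := by
  conv_lhs => rw [pi_eq_sum_univ' x]
  simp [LinearMap.sum_apply]

lemma polarForm_swap₁₂ (f : MvPolynomial (Fin 4) K) (x y z : Fin 4 → K) :
    polarForm f x y z = polarForm f y x z := by
  simp only [polarForm_apply, Finset.mul_sum]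
  rw [Finset.sum_comm]
  refine Finset.sum_congr rfl fun i _ => Finset.sum_congr rfl fun j _ =>
    Finset.sum_congr rfl fun l _ => ?_
  rw [pderiv_comm i j]
  ring

lemma polarForm_swap₂₃ (f : MvPolynomial (Fin 4) K) (x y z : Fin 4 → K) :
    polarForm f x y z = polarForm f x z y := by
  simp only [polarForm_apply, Finset.mul_sum]
  refine Finset.sum_congr rfl fun i _ => ?_
  rw [Finset.sum_comm]
  refine Finset.sum_congr rfl fun j _ => Finset.sum_congr rfl fun l _ => ?_
  rw [pderiv_comm j l]
  ring

lemma polarForm_map {L : Type*} [Field L] (φ : K →+* L) (f : MvPolynomial (Fin 4) K)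
    (x y z : Fin 4 → K) : polarForm (map φ f) (φ ∘ x) (φ ∘ y) (φ ∘ z) = φ (polarForm f x y z) := by
  have h6 : φ 6 = 6 := map_ofNat φ 6
  simp [polarForm_apply, pderiv_map, constantCoeff_map, h6]

variable [CharZero K] {f : MvPolynomial (Fin 4) K}

lemma eval_pderiv_eq_polarForm (hf : f.IsHomogeneous 3) (i : Fin 4) (x : Fin 4 → K) :
    eval x (pderiv i f) = 3 * polarForm f (Pi.single i 1) x x := by
  have h₁ := hf.pderiv (i := i)
  have e₁ := h₁.sum_mul_eval_pderiv x
  have e₂ := fun j => (h₁.pderiv (i := j)).sum_mul_eval_pderiv x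
  have e₃ := fun j l => ((h₁.pderiv (i := j)).pderiv (i := l)).eval_eq_constantCoeff x
  norm_num at e₁ e₂
  rw [polarForm_apply, Finset.sum_eq_single i (fun j _ hj => by simp [hj]) (by simp),
    Pi.single_eq_same, one_mul]
  have h2 : (2 : K) ≠ 0 := two_ne_zero
  refine mul_left_cancel₀ h2 ?_
  rw [← e₁, ← mul_assoc, Finset.mul_sum]
  refine Finset.sum_congr rfl fun j _ => ?_
  rw [← e₂, mul_left_comm, Finset.mul_sum _ _ (2 * 3 : K)]
  congr 1
  refine Finset.sum_congr rfl fun l _ => ?_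
  rw [e₃]
  ring

lemma eval_eq_polarForm (hf : f.IsHomogeneous 3) (x : Fin 4 → K) :
    eval x f = polarForm f x x x := by
  have h3 : (3 : K) ≠ 0 := three_ne_zero
  refine mul_left_cancel₀ h3 ?_
  have e := hf.sum_mul_eval_pderiv x
  norm_num at e
  rw [← e, polarForm_eq_sum, Finset.mul_sum]
  refine Finset.sum_congr rfl fun i _ => ?_
  rw [eval_pderiv_eq_polarForm hf]
  ring

end Polarization

section Bridge

variable {K : Type*} [Field K] [CharZero K] {f : MvPolynomial (Fin 4) K}

lemma IsSmoothCubic.eq_zero_of_polarForm_eq_zero (hf : IsSmoothCubic K f)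
    {x : Fin 4 → AlgebraicClosure K}
    (hx : ∀ u : Fin 4 → K, polarForm (map (algebraMap K (AlgebraicClosure K)) f)
      (algebraMap K (AlgebraicClosure K) ∘ u) x x = 0) : x = 0 := by
  have hf' := hf.2.1.map (algebraMap K (AlgebraicClosure K))
  have hx' : ∀ i, polarForm (map (algebraMap K (AlgebraicClosure K)) f) (Pi.single i 1) x x = 0 := by
    intro i
    convert hx (Pi.single i 1) using 4
    ext j
    obtain rfl | hij := eq_or_ne j i <;> simp [*]
  refine hf.2.2 x ⟨?_, fun i => ?_⟩
  · rw [eval_eq_polarForm hf', polarForm_eq_sum]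
    simp [hx']
  · rw [← pderiv_map, eval_pderiv_eq_polarForm hf', hx', mul_zero]

lemma exists_isotropic_pair {L : Type*} [Field L] [IsAlgClosed L] (a b c : L) :
    ∃ s t : L, (s, t) ≠ 0 ∧ s * s * a + 2 * s * t * b + t * t * c = 0 := by
  by_cases ha : a = 0
  · exact ⟨1, 0, by simp, by simp [ha]⟩
  · obtain ⟨d, hd⟩ := IsAlgClosed.exists_pow_nat_eq (b ^ 2 - a * c) two_pos
    exact ⟨d - b, a, by simp [ha], by linear_combination a * hd⟩

lemma eq_zero_of_smul_comp_add_smul_comp {ι L : Type*} [Field L] (φ : K →+* L) {v w : ι → K}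
    (h : LinearIndependent K ![v, w]) {s t : L} (e : s • (φ ∘ v) + t • (φ ∘ w) = 0) :
    (s, t) = 0 := by
  have he : ∀ i, s * φ (v i) + t * φ (w i) = 0 := fun i => by simpa using congrFun e i
  rw [LinearIndependent.pair_iff] at h
  obtain ⟨i, hi⟩ : ∃ i, v i ≠ 0 := by
    by_contra! hv
    have := (h 1 0 (by ext i; simp [hv])).1
    exact one_ne_zero this
  have ht : t = 0 := by
    by_contra ht
    refine hi (h (-w i) (v i) ?_).2
    ext j
    have : φ (-w i * v j + v i * w j) = 0 := by
      refine (mul_eq_zero.1 (?_ : t * _ = 0)).resolve_left ht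
      rw [map_add, map_mul, map_mul, map_neg]
      linear_combination φ (v i) * he j - φ (v j) * he i
    exact φ.injective (this.trans (map_zero φ).symm)
  have hs : s = 0 := by simpa [ht, hi] using he i
  simp [hs, ht]

theorem IsSmoothCubic.isSmooth_polarForm (hf : IsSmoothCubic K f) :
    CubicForm.IsSmooth (polarForm f) where
  swap₁₂ := polarForm_swap₁₂ f
  swap₂₃ := polarForm_swap₂₃ f
  point x hx := by
    by_contra! h
    have := hf.eq_zero_of_polarForm_eq_zero (x := algebraMap K (AlgebraicClosure K) ∘ x) fun u => by
      rw [polarForm_map, polarForm_swap₁₂, polarForm_swap₂₃, h, map_zero]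
    refine hx (funext fun i => ?_)
    simpa using congrFun this i
  plane W P hW hP := by
    by_contra! h
    obtain ⟨z, hz⟩ : ∃ z, z ∉ P := by
      by_contra! hz
      have : P = ⊤ := eq_top_iff.2 fun z _ => hz z
      rw [this, finrank_top] at hP
      simp at hP
    have hspan : ∀ u, ∃ p ∈ P, ∃ r : K, u = p + r • z := by
      have hlt : P < P ⊔ Submodule.span K {z} := by simpa using hz
      have : P ⊔ Submodule.span K {z} = ⊤ := by
        refine Submodule.eq_top_of_finrank_eq (le_antisymm (Submodule.finrank_le _) ?_)
        have := Submodule.finrank_lt_finrank_of_lt hlt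
        simp
        omega
      intro u
      obtain ⟨p, hp, q, hq, e⟩ := Submodule.mem_sup.1 (this ▸ Submodule.mem_top : u ∈ _)
      obtain ⟨r, rfl⟩ := Submodule.mem_span_singleton.1 hq
      exact ⟨p, hp, r, e.symm⟩
    obtain ⟨v, hv, hv0⟩ := Submodule.exists_mem_ne_zero_of_finrank_eq_two hW
    obtain ⟨w, hw, hvw⟩ := Submodule.exists_linearIndependent_pair hW hv0
    set φ := algebraMap K (AlgebraicClosure K) with hφ
    obtain ⟨s, t, hst, e⟩ := exists_isotropic_pair (φ (polarForm f z v v)) (φ (polarForm f z v w))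
      (φ (polarForm f z w w))
    refine hst (eq_zero_of_smul_comp_add_smul_comp φ hvw (hf.eq_zero_of_polarForm_eq_zero ?_))
    intro u
    obtain ⟨p, hp, r, rfl⟩ := hspan u
    have key : ∀ x ∈ W, ∀ y ∈ W, polarForm f p x y = 0 := fun x hx y hy => by
      rw [polarForm_swap₁₂, polarForm_swap₂₃, h x hx y hy p hp]
    simp only [map_add, map_smul, LinearMap.add_apply, LinearMap.smul_apply, smul_eq_mul,
      ← hφ, polarForm_map]
    rw [polarForm_swap₂₃ f z w v, key v hv v hv, key v hv w hw, key w hw v hv, key w hw w hw]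
    simp only [map_mul, map_zero]
    linear_combination φ r * e

lemma eval_lineRestrict {R : Type*} [CommRing R] (f : MvPolynomial (Fin 4) R) (v w : Fin 4 → R)
    (x : Fin 2 → R) : eval x (lineRestrict f v w) = eval (x 0 • v + x 1 • w) f := by
  rw [lineRestrict, ← coe_aeval_eq_eval, ← coe_aeval_eq_eval, RingHom.coe_coe, RingHom.coe_coe,
    comp_aeval_apply]
  congr 2
  ext i
  simp [mul_comm]

lemma isLineOn_iff (hf : f.IsHomogeneous 3) (W : Submodule K (Fin 4 → K)) :
    IsLineOn f W ↔ CubicForm.IsLine (polarForm f) W := by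
  refine and_congr_right fun hW => ⟨?_, fun h => ?_⟩
  · rintro ⟨v, w, rfl, h⟩
    have key : ∀ x ∈ Submodule.span K {v, w}, polarForm f x x x = 0 := by
      intro x hx
      obtain ⟨a, b, rfl⟩ := Submodule.mem_span_pair.1 hx
      rw [← eval_eq_polarForm hf]
      simpa [h] using (eval_lineRestrict f v w ![a, b]).symm
    intro x hx y hy z hz
    have h₁ := key _ (add_mem (add_mem hx hy) hz)
    have h₂ := key _ (add_mem hx hy)
    have h₃ := key _ (add_mem hx hz)
    have h₄ := key _ (add_mem hy hz)
    have h₅ := key _ hx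
    have h₆ := key _ hy
    have h₇ := key _ hz
    have s₁ := polarForm_swap₁₂ f
    have s₂ := polarForm_swap₂₃ f
    simp only [map_add, LinearMap.add_apply] at h₁ h₂ h₃ h₄
    have h6 : (6 : K) ≠ 0 := by norm_num
    refine (mul_eq_zero.1 (?_ : (6 : K) * _ = 0)).resolve_left h6
    rw [s₂ x z y, s₁ y x z, s₁ z x y, s₂ x z y, s₂ y z x, s₁ y x z, s₁ z y x, s₂ y z x,
      s₁ y x z] at h₁
    linear_combination h₁ - h₂ - h₃ - h₄ + h₅ + h₆ + h₇
  · obtain ⟨v, hv, hv0⟩ := Submodule.exists_mem_ne_zero_of_finrank_eq_two hW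
    obtain ⟨w, hw, hvw⟩ := Submodule.exists_linearIndependent_pair hW hv0
    refine ⟨v, w, (Submodule.eq_span_pair_of_finrank_eq_two hW hv hw hvw).symm,
      MvPolynomial.funext fun x => ?_⟩
    have hx : x 0 • v + x 1 • w ∈ W := add_mem (W.smul_mem _ hv) (W.smul_mem _ hw)
    rw [eval_lineRestrict, eval_eq_polarForm hf, h _ hx _ hx _ hx, map_zero]

end Bridge

/-- a smooth cubic surface over ℚ containing a skew triple of ℚ-lines
has 3, 7, 9, 15, or 27 rational lines. -/
theorem line_count_with_skew_triple_rat (f : MvPolynomial (Fin 4) ℚ)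
    (hf : IsSmoothCubic ℚ f)
    (hskew : ∃ W₁ W₂ W₃ : Submodule ℚ (Fin 4 → ℚ),
      IsLineOn f W₁ ∧ IsLineOn f W₂ ∧ IsLineOn f W₃ ∧
      W₁ ≠ W₂ ∧ W₁ ≠ W₃ ∧ W₂ ≠ W₃ ∧
      W₁ ⊓ W₂ = ⊥ ∧ W₁ ⊓ W₃ = ⊥ ∧ W₂ ⊓ W₃ = ⊥) :
    {W : Submodule ℚ (Fin 4 → ℚ) | IsLineOn f W}.Finite ∧
      {W : Submodule ℚ (Fin 4 → ℚ) | IsLineOn f W}.ncard ∈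
        ({3, 7, 9, 15, 27} : Set ℕ) := by
  obtain ⟨W₁, W₂, W₃, h₁, h₂, h₃, n₁₂, n₁₃, n₂₃, i₁₂, i₁₃, i₂₃⟩ := hskew
  rw [isLineOn_iff hf.2.1] at h₁ h₂ h₃
  have hcard := hf.isSmooth_polarForm.encard_lines_mem (by simp)
    (A := ⟨W₁, h₁⟩) (B := ⟨W₂, h₂⟩) (C := ⟨W₃, h₃⟩)
    ⟨fun e => n₁₂ (congrArg Subtype.val e), fun e => n₁₃ (congrArg Subtype.val e),
      fun e => n₂₃ (congrArg Subtype.val e), fun h => h.2 i₁₂, fun h => h.2 i₁₃, fun h => h.2 i₂₃⟩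
  rw [← Subtype.val_injective.encard_image, Set.image_univ, Subtype.range_coe_subtype] at hcard
  simp only [isLineOn_iff hf.2.1]
  refine ⟨Set.encard_ne_top_iff.1 fun h => ?_, ?_⟩
  · rw [h] at hcard
    simp at hcard
  · rw [Set.ncard_def]
    rcases hcard with h | h | h | h | h <;> rw [h] <;> simp
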